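/- arXiv:0804.4626 — 2 statements merged into one kernel-verified Lean document; each statement's English description precedes it below -/
import Mathlib

section
/- Conjugation symmetry of Littlewood–Richardson coefficients: for all partitions λ, μ, ν, c(λ^c; μ^c, ν^c) = c(λ; μ, ν), where α^c denotes the conjugate (transpose) partition. -/
/-- `f : ℕ → ℕ` represents a partition (0-indexed parts): weakly decreasing
and eventually zero. -/
def IsPartition (f : ℕ → ℕ) : Prop :=
  (∀ ⦃i j : ℕ⦄, i ≤ j → f j ≤ f i) ∧ ∃ N, ∀ i, N ≤ i → f i = 0

/-- The box `(i, j)` (row `i`, column `j`, both 0-indexed) lies in the skew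
diagram `l / m`. -/
def InSkew (l m : ℕ → ℕ) (p : ℕ × ℕ) : Prop :=
  m p.1 ≤ p.2 ∧ p.2 < l p.1

/-- `T` is a Littlewood–Richardson tableau of skew shape `l / m` and content `n`:
entries are positive exactly on the shape, rows weakly increase, columns strictly
increase, the number of entries equal to `k + 1` is `n k`, and every prefix of the
reverse reading word (right to left, top to bottom) is a lattice word. -/
structure IsLR (l m n : ℕ → ℕ) (T : ℕ → ℕ → ℕ) : Prop where
  support : ∀ p : ℕ × ℕ, T p.1 p.2 ≠ 0 ↔ InSkew l m p
  row_weak : ∀ i j, InSkew l m (i, j) → InSkew l m (i, j + 1) → T i j ≤ T i (j + 1)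
  col_strict : ∀ i j, InSkew l m (i, j) → InSkew l m (i + 1, j) → T i j < T (i + 1) j
  content : ∀ k : ℕ, Nat.card {p : ℕ × ℕ // T p.1 p.2 = k + 1} = n k
  lattice : ∀ i j k : ℕ,
    Nat.card {p : ℕ × ℕ // T p.1 p.2 = k + 2 ∧ (p.1 < i ∨ (p.1 = i ∧ j ≤ p.2))} ≤
      Nat.card {p : ℕ × ℕ // T p.1 p.2 = k + 1 ∧ (p.1 < i ∨ (p.1 = i ∧ j ≤ p.2))}

/-- The Littlewood–Richardson coefficient `c(l; m, n)`: the number of LR tableaux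
of shape `l / m` and content `n`. -/
noncomputable def LR (l m n : ℕ → ℕ) : ℕ :=
  Nat.card {T : ℕ → ℕ → ℕ // IsLR l m n T}

/-- The partition `a` is contained in the skew diagram `l / m`: some translate
of `a`, or of `a` rotated by 180°, is a subset of the diagram. -/
def ContainedIn (a l m : ℕ → ℕ) : Prop :=
  (∃ r c, ∀ i j, j < a i → InSkew l m (r + i, c + j)) ∨
  (∃ r c, ∀ i j, j < a i → i ≤ r ∧ j ≤ c ∧ InSkew l m (r - i, c - j))

/-- The complement of `f` in the rectangle with `L` rows of length `k`,
rotated by 180°, regarded as a partition. -/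
def RotCompl (k L : ℕ) (f : ℕ → ℕ) : ℕ → ℕ :=
  fun i => if i < L then k - f (L - 1 - i) else 0



namespace LRC

/-- Gelfand-Tsetlin type arrays encoding semistandard tableaux of shape `l / m`
with entries at most `L`: `g k i` is the end of the entries `≤ k` in row `i`. -/
structure IsArr (L : ℕ) (m l : ℤ → ℤ) (g : ℕ → ℤ → ℤ) : Prop where
  zero : g 0 = m
  top : ∀ k, L ≤ k → g k = l
  mono : ∀ k i, g k i ≤ g (k + 1) i
  inter : ∀ k i, g (k + 1) (i + 1) ≤ g k i

/-- Boundedness of a shape. -/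
structure Good (B : ℤ) (m l : ℤ → ℤ) : Prop where
  pos : 0 < B
  anti : ∀ i, m (i + 1) ≤ m i
  low : ∀ i, i ≤ -B → m i = l i
  high : ∀ i, B ≤ i → m i = l i
  lb : ∀ i, -B < m i
  ub : ∀ i, l i ≤ B

/-- number of entries `k + 1` in columns `≥ j`. -/
noncomputable def cntN (B : ℤ) (g : ℕ → ℤ → ℤ) (k : ℕ) (j : ℤ) : ℤ :=
  ∑ i ∈ Finset.Icc (-B) B, (max (g (k + 1) i) j - max (g k i) j)

/-- number of entries `k + 1` in columns `< j`. -/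
noncomputable def cntM (B : ℤ) (g : ℕ → ℤ → ℤ) (k : ℕ) (j : ℤ) : ℤ :=
  ∑ i ∈ Finset.Icc (-B) B, (min j (g (k + 1) i) - min j (g k i))

/-- number of entries `k + 1`. -/
noncomputable def cnt (B : ℤ) (g : ℕ → ℤ → ℤ) (k : ℕ) : ℤ :=
  ∑ i ∈ Finset.Icc (-B) B, (g (k + 1) i - g k i)

lemma cnt_eq (B : ℤ) (g : ℕ → ℤ → ℤ) (k : ℕ) (j : ℤ) :
    cnt B g k = cntN B g k j + cntM B g k j := by
  unfold cnt cntN cntM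
  rw [← Finset.sum_add_distrib]
  apply Finset.sum_congr rfl
  intro i _
  omega

/-- The Bender-Knuth toggle in columns `< j`. -/
def tog (j : ℤ) (k : ℕ) (g : ℕ → ℤ → ℤ) : ℕ → ℤ → ℤ := fun k' i =>
  if k' = k + 1 then
    max (g (k + 1) i) j - j + min (min j (g (k + 2) i)) (min j (g k (i - 1)))
      + max (min j (g (k + 2) (i + 1))) (min j (g k i)) - min j (g (k + 1) i)
  else g k' i

section
variable {L : ℕ} {m l : ℤ → ℤ} {g : ℕ → ℤ → ℤ} {j : ℤ} {k : ℕ} {B : ℤ}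

lemma IsArr.inter' (h : IsArr L m l g) (k : ℕ) (i : ℤ) : g (k + 1) i ≤ g k (i - 1) := by
  have := h.inter k (i - 1)
  simpa using this

lemma tog_ne {k' : ℕ} (h : k' ≠ k + 1) : tog j k g k' = g k' := by
  funext i; simp [tog, h]

lemma tog_max (h : IsArr L m l g) (hno : ∀ i, g k i ≤ j → g (k + 1) i ≤ j) (k' : ℕ) (i : ℤ) :
    max (tog j k g k' i) j = max (g k' i) j := by
  by_cases hk : k' = k + 1
  · subst hk
    have h1 := h.mono k i
    have h2 := h.mono (k + 1) i
    have h3 := h.inter' k i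
    have h4 := h.inter (k + 1) i
    have h5 := hno i
    simp only [tog, if_true]
    rw [show k + 1 + 1 = k + 2 from rfl] at h2 h4
    omega
  · rw [tog_ne hk]

lemma tog_min (h : IsArr L m l g) (hno : ∀ i, g k i ≤ j → g (k + 1) i ≤ j) (i : ℤ) :
    min j (tog j k g (k + 1) i) = min (min j (g (k + 2) i)) (min j (g k (i - 1)))
      + max (min j (g (k + 2) (i + 1))) (min j (g k i)) - min j (g (k + 1) i) := by
  have h1 := h.mono k i
  have h2 := h.mono (k + 1) i
  have h3 := h.inter' k i
  have h4 := h.inter (k + 1) i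
  have h5 := hno i
  simp only [tog, if_true]
  rw [show k + 1 + 1 = k + 2 from rfl] at h2 h4
  omega

lemma tog_isArr (h : IsArr L m l g) (hno : ∀ i, g k i ≤ j → g (k + 1) i ≤ j)
    (hk : k + 1 < L) : IsArr L m l (tog j k g) := by
  refine ⟨?_, ?_, ?_, ?_⟩
  · rw [tog_ne (by omega)]; exact h.zero
  · intro k' hk'
    rw [tog_ne (by omega)]; exact h.top k' hk'
  · intro k' i
    have h1 := h.mono k i
    have h2 := h.mono (k + 1) i
    have h3 := h.inter' k i
    have h4 := h.inter (k + 1) i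
    have h5 := hno i
    rw [show k + 1 + 1 = k + 2 from rfl] at h2 h4
    by_cases e1 : k' = k + 1
    · subst e1
      rw [tog_ne (k' := k + 1 + 1) (by omega)]
      simp only [tog, if_true]
      rw [show k + 1 + 1 = k + 2 from rfl]
      omega
    · by_cases e2 : k' = k
      · subst e2
        rw [tog_ne (k' := k') (by omega)]
        simp only [tog, if_true]
        omega
      · rw [tog_ne e1, tog_ne (by omega)]; exact h.mono k' i
  · intro k' i
    by_cases e1 : k' = k + 1
    · subst e1
      have h1 := h.mono k i
      have h2 := h.mono (k + 1) i
      have h3 := h.inter' k i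
      have h4 := h.inter (k + 1) i
      have h5 := hno i
      rw [show k + 1 + 1 = k + 2 from rfl] at h2 h4
      rw [tog_ne (k' := k + 1 + 1) (by omega)]
      simp only [tog, if_true]
      rw [show k + 1 + 1 = k + 2 from rfl]
      omega
    · by_cases e2 : k' = k
      · subst e2
        have h1 := h.mono k' (i + 1)
        have h2 := h.mono (k' + 1) (i + 1)
        have h3 := h.inter k' i
        have h4 := h.inter (k' + 1) (i + 1)
        have h5 := hno (i + 1)
        rw [show k' + 1 + 1 = k' + 2 from rfl] at h2 h4
        rw [tog_ne (k' := k') (by omega)]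
        simp only [tog, if_true, add_sub_cancel_right]
        omega
      · rw [tog_ne e1, tog_ne (by omega)]; exact h.inter k' i

lemma tog_no (hno : ∀ i, g k i ≤ j → g (k + 1) i ≤ j) (h : IsArr L m l g) (i : ℤ) :
    tog j k g k i ≤ j → tog j k g (k + 1) i ≤ j := by
  have h1 := tog_max h hno k i
  have h2 := tog_max h hno (k + 1) i
  have h5 := hno i
  omega

lemma tog_tog (h : IsArr L m l g) (hno : ∀ i, g k i ≤ j → g (k + 1) i ≤ j) :
    tog j k (tog j k g) = g := by
  funext k' i
  by_cases e1 : k' = k + 1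
  · subst e1
    have e := tog_min h hno i
    have e' := tog_max h hno (k + 1) i
    rw [tog]
    rw [tog_ne (k' := k) (by omega), tog_ne (k' := k + 2) (by omega)]
    simp only [if_true]
    omega
  · rw [tog_ne e1, tog_ne e1]

lemma IsArr.row_const (h : IsArr L m l g) {i : ℤ} (hi : m i = l i) (k : ℕ) : g k i = m i := by
  have hm : Monotone (fun k => g k i) := monotone_nat_of_le_succ (fun k => h.mono k i)
  have h1 : g 0 i ≤ g k i := hm (Nat.zero_le k)
  have h2 : g k i ≤ g (max k L) i := hm (le_max_left _ _)
  rw [h.top _ (le_max_right _ _)] at h2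
  rw [h.zero] at h1
  omega

lemma IsArr.bounds (h : IsArr L m l g) (k : ℕ) (i : ℤ) : m i ≤ g k i ∧ g k i ≤ l i := by
  have hm : Monotone (fun k => g k i) := monotone_nat_of_le_succ (fun k => h.mono k i)
  have h1 : g 0 i ≤ g k i := hm (Nat.zero_le k)
  have h2 : g k i ≤ g (max k L) i := hm (le_max_left _ _)
  rw [h.top _ (le_max_right _ _)] at h2
  rw [h.zero] at h1
  exact ⟨h1, h2⟩

lemma telescope (f : ℤ → ℤ) (a b : ℤ) (hab : a ≤ b + 1) :
    ∑ i ∈ Finset.Icc a b, (f (i + 1) - f i) = f (b + 1) - f a := by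
  obtain ⟨n, hn⟩ : ∃ n : ℕ, b = a + n - 1 := ⟨(b + 1 - a).toNat, by omega⟩
  subst hn
  clear hab
  induction n with
  | zero => simp
  | succ n ih =>
    have : Finset.Icc a (a + ((n + 1 : ℕ) : ℤ) - 1) =
        insert (a + n) (Finset.Icc a (a + (n : ℤ) - 1)) := by
      ext x; simp; omega
    rw [this, Finset.sum_insert (by simp), ih]
    push_cast
    ring_nf

lemma tog_sum (h : IsArr L m l g) (hB : Good B m l)
    (hno : ∀ i, g k i ≤ j → g (k + 1) i ≤ j) :
    ∑ i ∈ Finset.Icc (-B) B, (min j (tog j k g (k + 1) i) + min j (g (k + 1) i)) =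
    ∑ i ∈ Finset.Icc (-B) B, (min j (g (k + 2) i) + min j (g k i)) := by
  have ht := telescope (fun i => max (min j (g (k + 2) i) - min j (g k (i - 1))) 0) (-B) B
    (by have := hB.pos; omega)
  have e1 : max (min j (g (k + 2) (B + 1)) - min j (g k (B + 1 - 1))) 0 = 0 := by
    have a1 := h.row_const (hB.high (B + 1) (by omega)) (k + 2)
    have a2 := h.row_const (hB.high B (by omega)) k
    have a3 := hB.anti B
    rw [add_sub_cancel_right]
    omega
  have e2 : max (min j (g (k + 2) (-B)) - min j (g k (-B - 1))) 0 = 0 := by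
    have a1 := h.row_const (hB.low (-B) (by omega)) (k + 2)
    have a2 := h.row_const (hB.low (-B - 1) (by omega)) k
    have a3 := hB.anti (-B - 1)
    rw [sub_add_cancel] at a3
    omega
  simp only [e1, e2, sub_zero] at ht
  rw [← add_zero (∑ i ∈ Finset.Icc (-B) B, (min j (g (k + 2) i) + min j (g k i))), ← ht,
    ← Finset.sum_add_distrib]
  apply Finset.sum_congr rfl
  intro i _
  have := tog_min h hno i
  simp only [add_sub_cancel_right]
  omega

lemma tog_cntM0 (h : IsArr L m l g) (hB : Good B m l)
    (hno : ∀ i, g k i ≤ j → g (k + 1) i ≤ j) :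
    cntM B (tog j k g) k j = cntM B g (k + 1) j := by
  have := tog_sum h hB hno
  unfold cntM
  rw [tog_ne (k' := k) (by omega)]
  simp only [Finset.sum_add_distrib, Finset.sum_sub_distrib] at *
  rw [show k + 1 + 1 = k + 2 from rfl]
  linarith

lemma tog_cntM1 (h : IsArr L m l g) (hB : Good B m l)
    (hno : ∀ i, g k i ≤ j → g (k + 1) i ≤ j) :
    cntM B (tog j k g) (k + 1) j = cntM B g k j := by
  have := tog_sum h hB hno
  unfold cntM
  rw [tog_ne (k' := k + 1 + 1) (by omega)]
  simp only [Finset.sum_add_distrib, Finset.sum_sub_distrib] at *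
  rw [show k + 1 + 1 = k + 2 from rfl]
  linarith

lemma tog_cnt_ne {k' : ℕ} (h1 : k' ≠ k) (h2 : k' ≠ k + 1) :
    cnt B (tog j k g) k' = cnt B g k' := by
  unfold cnt
  rw [tog_ne (k' := k' + 1) (by omega), tog_ne (k' := k') (by omega)]

lemma tog_cntN (h : IsArr L m l g) (hno : ∀ i, g k i ≤ j → g (k + 1) i ≤ j)
    (k' : ℕ) {j' : ℤ} (hj : j ≤ j') : cntN B (tog j k g) k' j' = cntN B g k' j' := by
  unfold cntN
  apply Finset.sum_congr rfl
  intro i _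
  have h1 := tog_max h hno k' i
  have h2 := tog_max h hno (k' + 1) i
  omega

lemma tog_cnt0 (h : IsArr L m l g) (hB : Good B m l)
    (hno : ∀ i, g k i ≤ j → g (k + 1) i ≤ j) :
    cnt B (tog j k g) k = cnt B g (k + 1) + cntN B g k j - cntN B g (k + 1) j := by
  rw [cnt_eq B _ k j, cnt_eq B g (k + 1) j, tog_cntM0 h hB hno, tog_cntN h hno k le_rfl]
  ring

lemma tog_cnt1 (h : IsArr L m l g) (hB : Good B m l)
    (hno : ∀ i, g k i ≤ j → g (k + 1) i ≤ j) :
    cnt B (tog j k g) (k + 1) = cnt B g k + cntN B g (k + 1) j - cntN B g k j := by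
  rw [cnt_eq B _ (k + 1) j, cnt_eq B g k j, tog_cntM1 h hB hno, tog_cntN h hno (k + 1) le_rfl]
  ring

lemma cntN_nonneg (h : IsArr L m l g) (k : ℕ) (j : ℤ) : 0 ≤ cntN B g k j := by
  apply Finset.sum_nonneg
  intro i _
  have := h.mono k i
  omega

lemma cntN_big (h : IsArr L m l g) (hB : Good B m l) (k : ℕ) {j : ℤ} (hj : B ≤ j) :
    cntN B g k j = 0 := by
  apply Finset.sum_eq_zero
  intro i _
  have h1 := h.bounds k i
  have h2 := h.bounds (k + 1) i
  have := hB.ub i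
  omega

lemma cntN_low (h : IsArr L m l g) (hB : Good B m l) (k : ℕ) :
    cntN B g k (-B) = cnt B g k := by
  apply Finset.sum_congr rfl
  intro i _
  have h1 := h.bounds k i
  have h2 := h.bounds (k + 1) i
  have := hB.lb i
  omega

lemma cntN_top (h : IsArr L m l g) {k : ℕ} (hk : L ≤ k) (j : ℤ) : cntN B g k j = 0 := by
  apply Finset.sum_eq_zero
  intro i _
  rw [h.top k hk, h.top (k + 1) (by omega)]
  omega

lemma IsArr.antitone (h : IsArr L m l g) (hB : Good B m l) (k : ℕ) : Antitone (g k) := by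
  apply antitone_int_of_succ_le
  intro i
  cases k with
  | zero => rw [h.zero]; exact hB.anti i
  | succ k => exact (h.inter k i).trans (h.mono k i)

lemma cntN_step (B : ℤ) (g : ℕ → ℤ → ℤ) (hm : ∀ i, g k i ≤ g (k + 1) i) (j : ℤ) :
    cntN B g k j = cntN B g k (j + 1) +
      ((Finset.Icc (-B) B).filter (fun i => g k i ≤ j ∧ j < g (k + 1) i)).card := by
  unfold cntN
  rw [Finset.card_filter]
  push_cast
  rw [← Finset.sum_add_distrib]
  apply Finset.sum_congr rfl
  intro i _
  have := hm i
  split_ifs with h <;> omega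

/-- the first failure of the Yamanouchi property is at column `j` with letter `k`. -/
def First (B : ℤ) (g : ℕ → ℤ → ℤ) (j : ℤ) (k : ℕ) : Prop :=
  cntN B g k j < cntN B g (k + 1) j ∧
  (∀ j' k', j < j' → cntN B g (k' + 1) j' ≤ cntN B g k' j') ∧
  (∀ k', k' < k → cntN B g (k' + 1) j ≤ cntN B g k' j)

lemma First.unique {j₁ j₂ : ℤ} {k₁ k₂ : ℕ} (h₁ : First B g j₁ k₁) (h₂ : First B g j₂ k₂) :
    j₁ = j₂ ∧ k₁ = k₂ := by
  have hj : j₁ = j₂ := by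
    rcases lt_trichotomy j₁ j₂ with h | h | h
    · have := h₁.2.1 j₂ k₂ h; have := h₂.1; omega
    · exact h
    · have := h₂.2.1 j₁ k₁ h; have := h₁.1; omega
  subst hj
  refine ⟨rfl, ?_⟩
  rcases lt_trichotomy k₁ k₂ with h | h | h
  · have := h₂.2.2 k₁ h; have := h₁.1; omega
  · exact h
  · have := h₁.2.2 k₂ h; have := h₂.1; omega

lemma First.exists (h : IsArr L m l g) (hB : Good B m l)
    (hbad : ¬ ∀ j k, cntN B g (k + 1) j ≤ cntN B g k j) : ∃ j k, First B g j k := by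
  push Not at hbad
  obtain ⟨j, hj, hmax⟩ := Int.exists_greatest_of_bdd
    (P := fun j => ∃ k, cntN B g k j < cntN B g (k + 1) j)
    ⟨B, fun z ⟨k, hz⟩ => by
      by_contra hlt
      rw [cntN_big h hB _ (by omega), cntN_big h hB _ (by omega)] at hz
      omega⟩ hbad
  classical
  refine ⟨j, Nat.find hj, Nat.find_spec hj, ?_, ?_⟩
  · intro j' k' hj'
    by_contra hlt
    have := hmax j' ⟨k', by omega⟩
    omega
  · intro k' hk'
    have := Nat.find_min hj hk'
    omega

lemma First.lt (h : IsArr L m l g) (hf : First B g j k) : k + 1 < L := by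
  by_contra hk
  have h1 := hf.1
  rw [cntN_top h (k := k + 1) (by omega)] at h1
  have := cntN_nonneg (B := B) h k j
  omega

lemma First.spec (h : IsArr L m l g) (hB : Good B m l) (hf : First B g j k) :
    cntN B g (k + 1) j = cntN B g k j + 1 ∧ ∀ i, g k i ≤ j → g (k + 1) i ≤ j := by
  have h1 := hf.1
  have h2 := hf.2.1 (j + 1) k (by omega)
  have h3 := cntN_step B g (h.mono k) j
  have h4 := cntN_step B g (h.mono (k + 1)) j
  have h5 : ((Finset.Icc (-B) B).filter
      (fun i => g (k + 1) i ≤ j ∧ j < g (k + 1 + 1) i)).card ≤ 1 := by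
    rw [Finset.card_le_one]
    have key : ∀ a b : ℤ, g (k + 1) a ≤ j → j < g (k + 1 + 1) b → ¬ a < b := by
      intro a b ha hb hab
      have e1 := h.antitone hB (k + 1 + 1) (show a + 1 ≤ b by omega)
      have e2 := h.inter (k + 1) a
      omega
    intro a ha b hb
    simp only [Finset.mem_filter] at ha hb
    have := key a b ha.2.1 hb.2.2
    have := key b a hb.2.1 ha.2.2
    omega
  have h6 : ((Finset.Icc (-B) B).filter
      (fun i => g k i ≤ j ∧ j < g (k + 1) i)).card = 0 := by omega
  refine ⟨by omega, ?_⟩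
  intro i hi
  by_contra hlt
  by_cases hI : i ∈ Finset.Icc (-B) B
  · rw [Finset.card_eq_zero] at h6
    have : i ∈ (Finset.Icc (-B) B).filter (fun i => g k i ≤ j ∧ j < g (k + 1) i) := by
      simp only [Finset.mem_filter]; exact ⟨hI, hi, by omega⟩
    rw [h6] at this
    simp at this
  · have hml : m i = l i := by
      simp only [Finset.mem_Icc] at hI
      by_cases hi' : i ≤ -B
      · exact hB.low i hi'
      · exact hB.high i (by omega)
    rw [h.row_const hml] at hi hlt
    omega

lemma First.tog (h : IsArr L m l g) (hB : Good B m l) (hf : First B g j k) :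
    First B (tog j k g) j k := by
  have hno := (hf.spec h hB).2
  refine ⟨?_, ?_, ?_⟩
  · rw [tog_cntN h hno _ le_rfl, tog_cntN h hno _ le_rfl]; exact hf.1
  · intro j' k' hj'
    rw [tog_cntN h hno _ hj'.le, tog_cntN h hno _ hj'.le]; exact hf.2.1 j' k' hj'
  · intro k' hk'
    rw [tog_cntN h hno _ le_rfl, tog_cntN h hno _ le_rfl]; exact hf.2.2 k' hk'

lemma isArr_finite (hB : Good B m l) : {g | IsArr L m l g}.Finite := by
  have : Finite (Fin L → Finset.Icc (-B) B → Finset.Icc (-B) B) := inferInstance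
  let F : {g | IsArr L m l g} → (Fin L → Finset.Icc (-B) B → Finset.Icc (-B) B) :=
    fun g k i => ⟨g.1 k i, by
      have h1 := g.2.bounds k i
      have := hB.ub i
      have := hB.lb i
      simp only [Finset.mem_Icc]
      omega⟩
  exact Set.finite_coe_iff.mp <| Finite.of_injective F (by
    intro g g' hgg
    apply Subtype.ext
    funext k i
    by_cases hk : k < L
    · by_cases hI : i ∈ Finset.Icc (-B) B
      · have := congrArg Subtype.val (congrFun (congrFun hgg ⟨k, hk⟩) ⟨i, hI⟩)
        exact this
      · have hml : m i = l i := by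
          simp only [Finset.mem_Icc] at hI
          by_cases hi' : i ≤ -B
          · exact hB.low i hi'
          · exact hB.high i (by omega)
        rw [g.2.row_const hml, g'.2.row_const hml]
    · rw [g.2.top k (by omega), g'.2.top k (by omega)])

end
end LRC

namespace LRC
open Classical in
/-- The finset of arrays. -/
noncomputable def arrs (B : ℤ) (L : ℕ) (m l : ℤ → ℤ) : Finset (ℕ → ℤ → ℤ) :=
  if hB : Good B m l then (isArr_finite (L := L) hB).toFinset else ∅

section
variable {L : ℕ} {m l : ℤ → ℤ} {g : ℕ → ℤ → ℤ} {j : ℤ} {k : ℕ} {B : ℤ}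

lemma mem_arrs (hB : Good B m l) : g ∈ arrs B L m l ↔ IsArr L m l g := by
  simp [arrs, hB]

open Classical in
/-- Skew Kostka number. -/
noncomputable def kos (B : ℤ) (L : ℕ) (m l : ℤ → ℤ) (β : Fin L → ℤ) : ℕ :=
  ((arrs B L m l).filter (fun g => ∀ k : Fin L, cnt B g k = β k)).card

lemma swap_castSucc_apply {n : ℕ} (c : Fin n) (x : Fin (n + 1)) :
    ((Equiv.swap c.castSucc c.succ x : Fin (n + 1)) : ℕ) =
      if (x : ℕ) = c then (c : ℕ) + 1 else if (x : ℕ) = c + 1 then (c : ℕ) else x := by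
  rw [Equiv.swap_apply_def]
  simp only [Fin.ext_iff, Fin.val_castSucc, Fin.val_succ]
  split_ifs <;> simp

lemma kos_swap {n : ℕ} (hB : Good B m l) (β : Fin (n + 1) → ℤ) (c : Fin n) :
    kos B (n + 1) m l (β ∘ Equiv.swap c.castSucc c.succ) = kos B (n + 1) m l β := by
  classical
  have hno : ∀ g, IsArr (n + 1) m l g → ∀ i, g c i ≤ B → g (c + 1) i ≤ B := by
    intro g hg i _
    have := hg.bounds (c + 1) i
    have := hB.ub i
    omega
  have main : ∀ g, IsArr (n + 1) m l g → ∀ x : Fin (n + 1),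
      cnt B (tog B c g) x = cnt B g (Equiv.swap c.castSucc c.succ x : Fin (n + 1)) := by
    intro g hg x
    rw [swap_castSucc_apply]
    split_ifs with h1 h2
    · rw [h1, tog_cnt0 hg hB (hno g hg), cntN_big hg hB _ le_rfl, cntN_big hg hB _ le_rfl]; ring
    · rw [h2, tog_cnt1 hg hB (hno g hg), cntN_big hg hB _ le_rfl, cntN_big hg hB _ le_rfl]; ring
    · rw [tog_cnt_ne h1 h2]
  unfold kos
  apply Finset.card_nbij' (tog B c) (tog B c)
  · intro g hg
    simp only [Finset.coe_filter, Set.mem_ofPred_eq, mem_arrs hB] at hg ⊢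
    refine ⟨tog_isArr hg.1 (hno g hg.1) (by omega), fun x => ?_⟩
    rw [main g hg.1, hg.2]; simp
  · intro g hg
    simp only [Finset.coe_filter, Set.mem_ofPred_eq, mem_arrs hB] at hg ⊢
    refine ⟨tog_isArr hg.1 (hno g hg.1) (by omega), fun x => ?_⟩
    rw [main g hg.1, hg.2]; simp
  · intro g hg
    simp only [Finset.coe_filter, Set.mem_ofPred_eq, mem_arrs hB] at hg
    exact tog_tog hg.1 (hno g hg.1)
  · intro g hg
    simp only [Finset.coe_filter, Set.mem_ofPred_eq, mem_arrs hB] at hg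
    exact tog_tog hg.1 (hno g hg.1)

lemma kos_perm (hB : Good B m l) (w : Equiv.Perm (Fin L)) (β : Fin L → ℤ) :
    kos B L m l (β ∘ w) = kos B L m l β := by
  cases L with
  | zero => congr 1; funext x; exact x.elim0
  | succ n =>
    have hw : w ∈ Submonoid.closure
        (Set.range fun i : Fin n => Equiv.swap i.castSucc i.succ) := by
      rw [Equiv.Perm.mclosure_swap_castSucc_succ]; trivial
    induction hw using Submonoid.closure_induction generalizing β with
    | mem x hx =>
      obtain ⟨c, rfl⟩ := hx
      exact kos_swap hB β c
    | one => rfl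
    | mul x y _ _ hx hy =>
      have : β ∘ (x * y : Equiv.Perm (Fin (n + 1))) = (β ∘ x) ∘ y := rfl
      rw [this, hy, hx]

/-- Rotated array. -/
def rot (L : ℕ) (g : ℕ → ℤ → ℤ) : ℕ → ℤ → ℤ := fun k i => 1 - g (L - k) (-i)

/-- Rotated bound. -/
def rotb (l : ℤ → ℤ) : ℤ → ℤ := fun i => 1 - l (-i)

lemma rotb_rotb (l : ℤ → ℤ) : rotb (rotb l) = l := by
  funext i; simp [rotb]

lemma Good.rot (hB : Good B m l) (hl : ∀ i, l (i + 1) ≤ l i) : Good B (rotb l) (rotb m) := by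
  refine ⟨hB.pos, ?_, ?_, ?_, ?_, ?_⟩
  · intro i
    have := hl (-(i + 1))
    rw [show -(i + 1) + 1 = -i by ring] at this
    simp only [rotb]; omega
  · intro i hi
    simp only [rotb, hB.high (-i) (by omega)]
  · intro i hi
    simp only [rotb, hB.low (-i) (by omega)]
  · intro i
    have := hB.ub (-i)
    simp only [rotb]; omega
  · intro i
    have := hB.lb (-i)
    simp only [rotb]; omega

lemma IsArr.rot (h : IsArr L m l g) (hm : ∀ i, m (i + 1) ≤ m i) (hl : ∀ i, l (i + 1) ≤ l i) :
    IsArr L (rotb l) (rotb m) (rot L g) := by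
  refine ⟨?_, ?_, ?_, ?_⟩
  · funext i; simp [LRC.rot, rotb, h.top L le_rfl]
  · intro k hk
    funext i
    simp only [LRC.rot, rotb]
    rw [show L - k = 0 by omega, h.zero]
  · intro k i
    simp only [LRC.rot]
    by_cases hk : k < L
    · have := h.mono (L - (k + 1)) (-i)
      rw [show L - (k + 1) + 1 = L - k by omega] at this
      omega
    · rw [show L - k = 0 by omega, show L - (k + 1) = 0 by omega]
  · intro k i
    simp only [LRC.rot]
    by_cases hk : k < L
    · have := h.inter (L - (k + 1)) (-(i + 1))
      rw [show L - (k + 1) + 1 = L - k by omega, show -(i + 1) + 1 = -i by ring] at this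
      omega
    · rw [show L - k = 0 by omega, show L - (k + 1) = 0 by omega, h.zero]
      have := hm (-(i + 1))
      rw [show -(i + 1) + 1 = -i by ring] at this
      omega

lemma rot_rot (h : IsArr L m l g) : rot L (rot L g) = g := by
  funext k i
  simp only [rot, neg_neg, sub_sub_cancel]
  by_cases hk : k ≤ L
  · rw [show L - (L - k) = k by omega]
  · rw [show L - (L - k) = L by omega, h.top L le_rfl, h.top k (by omega)]

lemma sum_neg_Icc (B : ℤ) (f : ℤ → ℤ) :
    ∑ i ∈ Finset.Icc (-B) B, f (-i) = ∑ i ∈ Finset.Icc (-B) B, f i := by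
  apply Finset.sum_nbij' (fun i => -i) (fun i => -i)
  all_goals
    intro i hi
    simp only [Finset.mem_Icc, neg_neg] at *
    try omega

lemma cnt_rot (B : ℤ) (g : ℕ → ℤ → ℤ) (k : Fin L) :
    cnt B (rot L g) k = cnt B g (Fin.rev k : Fin L) := by
  unfold cnt
  rw [← sum_neg_Icc]
  apply Finset.sum_congr rfl
  intro i _
  simp only [rot, neg_neg, Fin.val_rev]
  have : L - (k : ℕ) = L - (k + 1) + 1 := by omega
  rw [this]
  ring

lemma kos_rot_le (hB : Good B m l) (hl : ∀ i, l (i + 1) ≤ l i) (β : Fin L → ℤ) :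
    kos B L m l β ≤ kos B L (rotb l) (rotb m) β := by
  classical
  rw [← kos_perm (hB.rot hl) (Fin.revPerm) β]
  unfold kos
  apply Finset.card_le_card_of_injOn (rot L)
  · intro g hg
    simp only [Finset.coe_filter, Set.mem_ofPred_eq, mem_arrs hB, mem_arrs (hB.rot hl)] at hg ⊢
    refine ⟨hg.1.rot hB.anti hl, fun x => ?_⟩
    rw [cnt_rot, hg.2]; simp
  · intro g hg g' hg' hgg
    simp only [Finset.coe_filter, Set.mem_ofPred_eq, mem_arrs hB] at hg hg'
    rw [← rot_rot hg.1, ← rot_rot hg'.1, hgg]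

lemma kos_rot (hB : Good B m l) (hl : ∀ i, l (i + 1) ≤ l i) (β : Fin L → ℤ) :
    kos B L m l β = kos B L (rotb l) (rotb m) β := by
  apply le_antisymm (kos_rot_le hB hl β)
  have hm' : ∀ i, rotb m (i + 1) ≤ rotb m i := by
    intro i
    have := hB.anti (-(i + 1))
    rw [show -(i + 1) + 1 = -i by ring] at this
    simp only [rotb]; omega
  have := kos_rot_le (hB.rot hl) hm' β
  rwa [rotb_rotb, rotb_rotb] at this

/-- Yamanouchi property by columns. -/
def Yam (B : ℤ) (g : ℕ → ℤ → ℤ) : Prop := ∀ j k, cntN B g (k + 1) j ≤ cntN B g k j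

open Classical in
/-- column LR arrays -/
noncomputable def colLR (B : ℤ) (L : ℕ) (m l : ℤ → ℤ) (ν : ℕ → ℤ) : Finset (ℕ → ℤ → ℤ) :=
  (arrs B L m l).filter (fun g => Yam B g ∧ ∀ k : Fin L, cnt B g k = ν k)

lemma mono_perm (w : Equiv.Perm (Fin L)) (a b : Fin L → ℤ) (ha : StrictAnti a) (hb : StrictAnti b)
    (h : ∀ x, a (w x) = b x) : w = 1 := by
  have hw : StrictMono w := by
    intro x y hxy
    have := hb hxy
    rw [← h, ← h] at this
    exact ha.lt_iff_gt.mp this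
  have : Set.range w = Set.range (id : Fin L → Fin L) := by simp
  have := (StrictMono.range_inj hw strictMono_id).mp this
  ext x; simp [this]

open Classical in
lemma signed (hB : Good B m l) (ν : ℕ → ℤ) (hν : ∀ k, ν (k + 1) ≤ ν k) :
    ((colLR B L m l ν).card : ℤ) = ∑ w : Equiv.Perm (Fin L), (Equiv.Perm.sign w : ℤ) *
      kos B L m l (fun x => ν (w⁻¹ x : Fin L) - ((w⁻¹ x : Fin L) : ℕ) + (x : ℕ)) := by
  have hcond : ∀ (w : Equiv.Perm (Fin L)) (g : ℕ → ℤ → ℤ),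
      (∀ x : Fin L, cnt B g x = ν (w⁻¹ x : Fin L) - ((w⁻¹ x : Fin L) : ℕ) + (x : ℕ)) ↔
      (∀ x : Fin L, cnt B g (w x : Fin L) - ((w x : Fin L) : ℕ) = ν x - (x : ℕ)) := by
    intro w g
    constructor
    · intro h x
      have := h (w x)
      rw [show w⁻¹ (w x) = x by simp] at this
      omega
    · intro h x
      have := h (w⁻¹ x)
      rw [show w (w⁻¹ x) = x by simp] at this
      omega
  let S : Finset (Equiv.Perm (Fin L) × (ℕ → ℤ → ℤ)) :=
    (Finset.univ ×ˢ arrs B L m l).filter (fun p =>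
      ∀ x : Fin L, cnt B p.2 (p.1 x : Fin L) - ((p.1 x : Fin L) : ℕ) = ν x - (x : ℕ))
  have hS : ∀ p, p ∈ S ↔ IsArr L m l p.2 ∧
      ∀ x : Fin L, cnt B p.2 (p.1 x : Fin L) - ((p.1 x : Fin L) : ℕ) = ν x - (x : ℕ) := by
    intro p; simp [S, mem_arrs hB]
  have e1 : ∑ w : Equiv.Perm (Fin L), (Equiv.Perm.sign w : ℤ) *
      kos B L m l (fun x => ν (w⁻¹ x : Fin L) - ((w⁻¹ x : Fin L) : ℕ) + (x : ℕ)) =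
      ∑ p ∈ S, (Equiv.Perm.sign p.1 : ℤ) := by
    simp only [S]
    rw [Finset.sum_filter, Finset.sum_product]
    apply Finset.sum_congr rfl
    intro w _
    unfold kos
    rw [Finset.card_filter]
    push_cast
    rw [Finset.mul_sum]
    apply Finset.sum_congr rfl
    intro g _
    simp only [hcond w g]
    split_ifs <;> simp
  have e2 : ∑ p ∈ S.filter (fun p => ¬ Yam B p.2), (Equiv.Perm.sign p.1 : ℤ) = 0 := by
    have hex : ∀ p ∈ S.filter (fun p => ¬ Yam B p.2), ∃ q : ℤ × ℕ, First B p.2 q.1 q.2 := by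
      intro p hp
      rw [Finset.mem_filter, hS] at hp
      obtain ⟨j, k, h⟩ := First.exists hp.1.1 hB hp.2
      exact ⟨(j, k), h⟩
    choose! q hq using hex
    have hlt : ∀ p ∈ S.filter (fun p => ¬ Yam B p.2), (q p).2 + 1 < L := by
      intro p hp
      have hp' := hp
      rw [Finset.mem_filter, hS] at hp'
      exact (hq p hp).lt hp'.1.1
    let sw : ℕ → Equiv.Perm (Fin L) := fun k =>
      if h : k + 1 < L then Equiv.swap ⟨k, by omega⟩ ⟨k + 1, h⟩ else 1
    have hsign : ∀ k, k + 1 < L → Equiv.Perm.sign (sw k) = -1 := by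
      intro k hk
      simp only [sw, hk, dif_pos]
      apply Equiv.Perm.sign_swap
      intro h; simp [Fin.ext_iff] at h
    have hsq : ∀ k, sw k * sw k = 1 := by
      intro k
      simp only [sw]
      split_ifs <;> simp
    have hmem : ∀ p ∈ S.filter (fun p => ¬ Yam B p.2),
        (sw (q p).2 * p.1, tog (q p).1 (q p).2 p.2) ∈ S.filter (fun p => ¬ Yam B p.2) := by
      intro p hp
      have hf := hq p hp
      have hl := hlt p hp
      rw [Finset.mem_filter, hS] at hp
      rw [Finset.mem_filter, hS]
      obtain ⟨hs1, hno⟩ := hf.spec hp.1.1 hB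
      refine ⟨⟨tog_isArr hp.1.1 hno hl, ?_⟩, ?_⟩
      · intro x
        rw [← hp.1.2 x]
        simp only [Equiv.Perm.mul_apply]
        generalize p.1 x = y
        have hsw : ((sw (q p).2 y : Fin L) : ℕ) =
            if (y : ℕ) = (q p).2 then (q p).2 + 1 else
              if (y : ℕ) = (q p).2 + 1 then (q p).2 else y := by
          simp only [sw, hl, dif_pos]
          rw [Equiv.swap_apply_def]
          simp only [Fin.ext_iff]
          split_ifs <;> simp
        rw [hsw]
        split_ifs with h1 h2
        · rw [h1, tog_cnt1 hp.1.1 hB hno]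
          push_cast; omega
        · rw [h2, tog_cnt0 hp.1.1 hB hno]
          push_cast; omega
        · rw [tog_cnt_ne h1 h2]
      · intro hY
        have := (hf.tog hp.1.1 hB).1
        have := hY (q p).1 (q p).2
        simp only at *
        omega
    refine Finset.sum_involution (fun p _ => (sw (q p).2 * p.1, tog (q p).1 (q p).2 p.2))
      ?_ ?_ hmem ?_
    · intro p hp
      simp [hsign _ (hlt p hp)]
    · intro p hp _ heq
      have h1 := congrArg (fun p => Equiv.Perm.sign p.1) heq
      simp only [Equiv.Perm.sign_mul, hsign _ (hlt p hp)] at h1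
      have h2 := Int.units_eq_one_or (Equiv.Perm.sign p.1)
      rcases h2 with h2 | h2 <;> rw [h2] at h1 <;> simp at h1
    · intro p hp
      have hf := hq p hp
      have hf2 := hq _ (hmem p hp)
      have hp' := hp
      rw [Finset.mem_filter, hS] at hp'
      have hf3 := hf.tog hp'.1.1 hB
      obtain ⟨a1, a2⟩ := hf2.unique hf3
      simp only [a1, a2]
      rw [tog_tog hp'.1.1 (hf.spec hp'.1.1 hB).2, ← mul_assoc, hsq, one_mul]
  rw [e1, ← Finset.sum_filter_add_sum_filter_not S (fun p => Yam B p.2), e2, add_zero]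
  have hone : ∀ p ∈ S.filter (fun p => Yam B p.2), p.1 = 1 := by
    intro p hp
    rw [Finset.mem_filter, hS] at hp
    apply mono_perm p.1 (fun y => cnt B p.2 y - (y : ℕ)) (fun x => ν x - (x : ℕ))
    · intro x y hxy
      have hanti : Antitone (fun k => cnt B p.2 k) := antitone_nat_of_succ_le (by
        intro k
        have := hp.2 (-B) k
        rwa [cntN_low hp.1.1 hB, cntN_low hp.1.1 hB] at this)
      have h1 := hanti (Fin.le_def.mp hxy.le)
      have h2 : (x : ℕ) < y := hxy
      simp only at h1 ⊢
      omega
    · intro x y hxy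
      have h1 := antitone_nat_of_succ_le hν (Fin.le_def.mp hxy.le)
      have h2 : (x : ℕ) < y := hxy
      simp only at h1 ⊢
      omega
    · exact hp.1.2
  rw [Finset.sum_congr rfl (fun p hp => by rw [hone p hp])]
  simp only [Equiv.Perm.sign_one, Units.val_one, Finset.sum_const, nsmul_eq_mul, mul_one]
  norm_cast
  apply Finset.card_nbij' (fun g => ((1 : Equiv.Perm (Fin L)), g)) (fun p => p.2)
  · intro g hg
    simp only [colLR, Finset.coe_filter, Set.mem_ofPred_eq, mem_arrs hB] at hg
    simp only [Finset.coe_filter, Set.mem_ofPred_eq, hS]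
    exact ⟨⟨hg.1, fun x => by simp [hg.2.2 x]⟩, hg.2.1⟩
  · intro p hp
    have h1 := hone p hp
    simp only [Finset.coe_filter, Set.mem_ofPred_eq, hS] at hp
    simp only [colLR, Finset.coe_filter, Set.mem_ofPred_eq, mem_arrs hB]
    refine ⟨hp.1.1, hp.2, fun x => ?_⟩
    have := hp.1.2 x
    rw [h1] at this
    simpa using this
  · intro g _; rfl
  · intro p hp
    exact Prod.ext (hone p hp).symm rfl

lemma colLR_rot (hB : Good B m l) (hl : ∀ i, l (i + 1) ≤ l i) (ν : ℕ → ℤ)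
    (hν : ∀ k, ν (k + 1) ≤ ν k) :
    (colLR B L m l ν).card = (colLR B L (rotb l) (rotb m) ν).card := by
  have h1 := signed (L := L) hB ν hν
  have h2 := signed (L := L) (hB.rot hl) ν hν
  have : ((colLR B L m l ν).card : ℤ) = (colLR B L (rotb l) (rotb m) ν).card := by
    rw [h1, h2]
    apply Finset.sum_congr rfl
    intro w _
    rw [kos_rot hB hl]
  exact_mod_cast this

end
end LRC

namespace LRC

lemma card_region (B : ℤ) (a b : ℤ → ℤ) (h0 : ∀ i, 0 ≤ i → 0 ≤ a i)
    (hab : ∀ i, a i ≤ b i) (hneg : ∀ i, i < 0 → a i = b i) (hbig : ∀ i, B ≤ i → a i = b i) :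
    (Nat.card {p : ℕ × ℕ // a p.1 ≤ p.2 ∧ (p.2 : ℤ) < b p.1} : ℤ) =
      ∑ i ∈ Finset.Icc (-B) B, (b i - a i) := by
  let s : Finset (ℕ × ℕ) := (Finset.sigma (Finset.range B.toNat)
    (fun i => Finset.Ico (a i).toNat (b i).toNat)).map (Equiv.sigmaEquivProd ℕ ℕ).toEmbedding
  have hs : ∀ p : ℕ × ℕ, p ∈ s ↔ (a p.1 ≤ p.2 ∧ (p.2 : ℤ) < b p.1) := by
    rintro ⟨i, c⟩
    have e1 := h0 i (by omega)
    have e2 := hab i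
    have e3 := hbig i
    simp only [s, Finset.mem_map, Finset.mem_sigma, Finset.mem_range, Finset.mem_Ico]
    constructor
    · rintro ⟨⟨x, y⟩, h, heq⟩
      simp [Equiv.sigmaEquivProd] at heq
      obtain ⟨rfl, rfl⟩ := heq
      simp only at h ⊢
      omega
    · rintro ⟨h1, h2⟩
      refine ⟨⟨i, c⟩, ?_, rfl⟩
      simp only at h1 h2 ⊢
      omega
  rw [Nat.subtype_card s hs]
  simp only [s, Finset.card_map, Finset.card_sigma, Nat.card_Ico]
  have : ∑ i ∈ (Finset.range B.toNat).map Nat.castEmbedding, (b i - a i) =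
      ∑ i ∈ Finset.Icc (-B) B, (b i - a i) := by
    apply Finset.sum_subset
    · intro x hx
      simp only [Finset.mem_map, Finset.mem_range, Nat.castEmbedding_apply] at hx
      obtain ⟨y, hy, rfl⟩ := hx
      simp only [Finset.mem_Icc]; omega
    · intro x hx hx'
      by_cases h1 : x < 0
      · rw [hneg x h1, sub_self]
      · by_cases h2 : B ≤ x
        · rw [hbig x h2, sub_self]
        · exfalso
          apply hx'
          simp only [Finset.mem_map, Finset.mem_range, Nat.castEmbedding_apply]
          exact ⟨x.toNat, by omega, by omega⟩
  rw [← this, Finset.sum_map]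
  push_cast
  apply Finset.sum_congr rfl
  intro i _
  have e1 := h0 i (by omega)
  have e2 := hab i
  simp only [Nat.castEmbedding_apply]
  omega

lemma yam_of_row {B : ℤ} {L : ℕ} {m l : ℤ → ℤ} {g : ℕ → ℤ → ℤ} (h : IsArr L m l g)
    (hB : Good B m l) (hm : ∀ i, 0 ≤ m i) (hl : ∀ i, B ≤ i → l i = 0)
    (hrow : ∀ (k : ℕ) (i : ℤ), 0 ≤ i →
      ∑ r ∈ Finset.Icc (-B) B, (if r ≤ i then g (k + 2) r - g (k + 1) r else 0) ≤
      ∑ r ∈ Finset.Icc (-B) B, (if r < i then g (k + 1) r - g k r else 0))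
    (hneg : ∀ k i, i < 0 → g (k + 1) i = g k i) : Yam B g := by
  have main : ∀ j k, 0 ≤ j → cntN B g (k + 1) j ≤ cntN B g k j := by
    intro j k hj
    by_cases hall : ∀ i, 0 ≤ i → g (k + 2) i ≤ j
    · have : cntN B g (k + 1) j = 0 := by
        apply Finset.sum_eq_zero
        intro i _
        have e := h.mono (k + 1) i
        rw [show k + 1 + 1 = k + 2 from rfl] at e ⊢
        by_cases hi : 0 ≤ i
        · have := hall i hi; omega
        · have := hneg (k + 1) i (by omega)
          rw [show k + 1 + 1 = k + 2 from rfl] at this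
          omega
      rw [this]
      exact cntN_nonneg h k j
    · push Not at hall
      obtain ⟨i, ⟨hi0, hij⟩, hmax⟩ := Int.exists_greatest_of_bdd
        (P := fun i => 0 ≤ i ∧ j < g (k + 2) i)
        ⟨B, fun z ⟨_, hz⟩ => by
          by_contra hlt
          have e1 := h.bounds (k + 2) z
          have e2 := hl z (by omega)
          omega⟩ hall
      have hiB : i < B := by
        by_contra hlt
        have e1 := h.bounds (k + 2) i
        have e2 := hl i (by omega)
        omega
      have hr := hrow k i hi0
      set δ := max (g (k + 1) i) j - g (k + 1) i with hδ
      set δ' := max (g k (i - 1)) j - g k (i - 1) with hδ'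
      have hdd : δ' ≤ δ := by
        have := h.inter' k i
        omega
      have a1 : cntN B g (k + 1) j =
          ∑ r ∈ Finset.Icc (-B) B, (if r ≤ i then g (k + 2) r - g (k + 1) r else 0) -
          ∑ r ∈ Finset.Icc (-B) B, (if r = i then δ else 0) := by
        rw [← Finset.sum_sub_distrib]
        apply Finset.sum_congr rfl
        intro r _
        rw [show k + 1 + 1 = k + 2 from rfl]
        have e := h.mono (k + 1) r
        rw [show k + 1 + 1 = k + 2 from rfl] at e
        rcases lt_trichotomy r i with hri | hri | hri
        · have e1 := h.inter (k + 1) r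
          have e2 := h.antitone hB (k + 2) (show r + 1 ≤ i by omega)
          rw [show k + 1 + 1 = k + 2 from rfl] at e1
          rw [if_pos hri.le, if_neg hri.ne]
          omega
        · subst hri
          rw [if_pos le_rfl, if_pos rfl]
          omega
        · rw [if_neg (by omega), if_neg (by omega)]
          have : g (k + 2) r ≤ j := by
            by_contra hlt
            have := hmax r ⟨by omega, by omega⟩
            omega
          omega
      have a2 : ∑ r ∈ Finset.Icc (-B) B, (if r < i then g (k + 1) r - g k r else 0) -
          ∑ r ∈ Finset.Icc (-B) B, (if r = i - 1 then δ' else 0) ≤ cntN B g k j := by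
        rw [← Finset.sum_sub_distrib]
        apply Finset.sum_le_sum
        intro r _
        have e := h.mono k r
        have key : r < i → j < g (k + 1) r := by
          intro hri
          have e1 := h.inter (k + 1) r
          have e2 := h.antitone hB (k + 2) (show r + 1 ≤ i by omega)
          rw [show k + 1 + 1 = k + 2 from rfl] at e1
          omega
        rcases lt_trichotomy r (i - 1) with hri | hri | hri
        · have e1 := h.inter k r
          have e2 := h.inter (k + 1) (r + 1)
          have e3 := h.antitone hB (k + 2) (show r + 1 + 1 ≤ i by omega)
          rw [show k + 1 + 1 = k + 2 from rfl] at e2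
          rw [if_pos (by omega), if_neg hri.ne]
          omega
        · subst hri
          have := key (by omega)
          rw [if_pos (by omega), if_pos rfl]
          omega
        · rw [if_neg (by omega), if_neg (by omega)]
          omega
      have hBp := hB.pos
      rw [Finset.sum_ite_eq' , if_pos (by simp only [Finset.mem_Icc]; omega)] at a1 a2
      omega
  intro j k
  by_cases hj : 0 ≤ j
  · exact main j k hj
  · have : ∀ k, cntN B g k j = cntN B g k 0 := by
      intro k
      apply Finset.sum_congr rfl
      intro i _
      have e1 := h.bounds k i
      have e2 := h.bounds (k + 1) i
      have e3 := hm i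
      omega
    rw [this, this]
    exact main 0 k le_rfl

/-- extended outer bound -/
def lZ (l : ℕ → ℕ) : ℤ → ℤ := fun i => if 0 ≤ i then (l i.toNat : ℤ) else l 0

/-- extended inner bound -/
def mZ (l m : ℕ → ℕ) : ℤ → ℤ := fun i =>
  if 0 ≤ i then ((min (m i.toNat) (l i.toNat) : ℕ) : ℤ) else l 0

lemma lZ_nat (l : ℕ → ℕ) (i : ℕ) : lZ l i = l i := by simp [lZ]
lemma mZ_nat (l m : ℕ → ℕ) (i : ℕ) : mZ l m i = (min (m i) (l i) : ℕ) := by simp [mZ]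
lemma lZ_neg (l : ℕ → ℕ) {i : ℤ} (h : i < 0) : lZ l i = l 0 := by
  simp only [lZ]; rw [if_neg (by omega)]
lemma mZ_neg (l m : ℕ → ℕ) {i : ℤ} (h : i < 0) : mZ l m i = l 0 := by
  simp only [mZ]; rw [if_neg (by omega)]

lemma int_cases (i : ℤ) : (∃ r : ℕ, i = r) ∨ i < 0 := by
  by_cases h : 0 ≤ i
  · exact Or.inl ⟨i.toNat, by omega⟩
  · exact Or.inr (by omega)

lemma lZ_anti {l : ℕ → ℕ} (hl : IsPartition l) (i : ℤ) : lZ l (i + 1) ≤ lZ l i := by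
  rcases int_cases i with ⟨r, rfl⟩ | hi
  · rw [show (r : ℤ) + 1 = ((r + 1 : ℕ) : ℤ) by push_cast; rfl, lZ_nat, lZ_nat]
    exact_mod_cast hl.1 (Nat.le_succ r)
  · rw [lZ_neg l hi]
    rcases int_cases (i + 1) with ⟨r, hr⟩ | hi
    · rw [hr, lZ_nat]; exact_mod_cast hl.1 (Nat.zero_le r)
    · rw [lZ_neg l hi]

lemma good_ext {l m : ℕ → ℕ} (hl : IsPartition l) (hm : IsPartition m) :
    ∃ B : ℤ, Good B (mZ l m) (lZ l) ∧ ∀ i, B ≤ i → lZ l i = 0 := by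
  obtain ⟨N, hN⟩ := hl.2
  have hbig : ∀ i : ℤ, ((l 0 + N + 1 : ℕ) : ℤ) ≤ i → lZ l i = 0 := by
    intro i hi
    obtain ⟨r, rfl⟩ : ∃ r : ℕ, i = r := ⟨i.toNat, by omega⟩
    rw [lZ_nat, hN r (by omega)]; rfl
  refine ⟨(l 0 + N + 1 : ℕ), ⟨by positivity, ?_, ?_, ?_, ?_, ?_⟩, hbig⟩
  · intro i
    rcases int_cases i with ⟨r, rfl⟩ | hi
    · rw [show (r : ℤ) + 1 = ((r + 1 : ℕ) : ℤ) by push_cast; rfl, mZ_nat, mZ_nat]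
      have := hl.1 (Nat.le_succ r)
      have := hm.1 (Nat.le_succ r)
      simp only [Nat.succ_eq_add_one] at *
      omega
    · rw [mZ_neg l m hi]
      rcases int_cases (i + 1) with ⟨r, hr⟩ | hi
      · rw [hr, mZ_nat]
        have := hl.1 (Nat.zero_le r)
        omega
      · rw [mZ_neg l m hi]
  · intro i hi
    rw [mZ_neg l m (by omega), lZ_neg l (by omega)]
  · intro i hi
    have := hbig i hi
    obtain ⟨r, rfl⟩ : ∃ r : ℕ, i = r := ⟨i.toNat, by omega⟩
    rw [this]
    rw [lZ_nat] at this
    rw [mZ_nat]; omega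
  · intro i
    rcases int_cases i with ⟨r, rfl⟩ | hi
    · rw [mZ_nat]; omega
    · rw [mZ_neg l m hi]; omega
  · intro i
    rcases int_cases i with ⟨r, rfl⟩ | hi
    · rw [lZ_nat]
      have := hl.1 (Nat.zero_le r)
      omega
    · rw [lZ_neg l hi]; omega

lemma gN_ex (l m : ℕ → ℕ) (T : ℕ → ℕ → ℕ) (k i : ℕ) :
    ∃ c, min (m i) (l i) ≤ c ∧ (l i ≤ c ∨ k < T i c) := ⟨l i, by omega, Or.inl le_rfl⟩

open Classical in
/-- end of entries `≤ k` in row `i` -/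
noncomputable def gN (l m : ℕ → ℕ) (T : ℕ → ℕ → ℕ) (k i : ℕ) : ℕ := Nat.find (gN_ex l m T k i)

/-- extension of `gN` -/
noncomputable def gZ (l m : ℕ → ℕ) (T : ℕ → ℕ → ℕ) (k : ℕ) (i : ℤ) : ℤ :=
  if 0 ≤ i then (gN l m T k i.toNat : ℤ) else l 0

section
variable {l m n : ℕ → ℕ} {T : ℕ → ℕ → ℕ}

lemma gZ_nat (k i : ℕ) : gZ l m T k i = gN l m T k i := by simp [gZ]
lemma gZ_neg (k : ℕ) {i : ℤ} (h : i < 0) : gZ l m T k i = l 0 := by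
  simp only [gZ]; rw [if_neg (by omega)]

lemma gN_ge (k i : ℕ) : min (m i) (l i) ≤ gN l m T k i := by
  classical exact (Nat.find_spec (gN_ex l m T k i)).1

lemma gN_le (k i : ℕ) : gN l m T k i ≤ l i := by
  classical exact Nat.find_min' (gN_ex l m T k i) ⟨by omega, Or.inl le_rfl⟩

lemma row_mono (h : IsLR l m n T) {i c d : ℕ} (hc : InSkew l m (i, c)) (hd : InSkew l m (i, d))
    (hcd : c ≤ d) : T i c ≤ T i d := by
  induction d, hcd using Nat.le_induction with
  | base => exact le_rfl
  | succ d hcd ih =>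
    have : InSkew l m (i, d) := by simp only [InSkew] at *; omega
    exact (ih this).trans (h.row_weak i d this hd)

lemma gN_iff (h : IsLR l m n T) {k i c : ℕ} (hc : InSkew l m (i, c)) :
    c < gN l m T k i ↔ T i c ≤ k := by
  classical
  constructor
  · intro hlt
    have := Nat.find_min (gN_ex l m T k i) hlt
    simp only [InSkew] at hc
    omega
  · intro hT
    by_contra hge
    have hs := Nat.find_spec (gN_ex l m T k i)
    change _ ≤ gN l m T k i ∧ (_ ≤ gN l m T k i ∨ k < T i (gN l m T k i)) at hs
    have hg : InSkew l m (i, gN l m T k i) := by simp only [InSkew] at *; omega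
    have := row_mono h hg hc (by omega)
    simp only [InSkew] at hg
    omega

lemma T_eq_iff (h : IsLR l m n T) (k i c : ℕ) :
    T i c = k + 1 ↔ gN l m T k i ≤ c ∧ c < gN l m T (k + 1) i := by
  by_cases hc : InSkew l m (i, c)
  · rw [gN_iff h hc, ← not_lt, gN_iff h hc]; omega
  · have h0 : T i c = 0 := by
      by_contra h1; exact hc ((h.support (i, c)).mp h1)
    have h1 := gN_ge (l := l) (m := m) (T := T) k i
    have h2 := gN_le (l := l) (m := m) (T := T) (k + 1) i
    simp only [InSkew] at hc
    omega

lemma gN_zero (h : IsLR l m n T) (i : ℕ) : gN l m T 0 i = min (m i) (l i) := by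
  have h1 := gN_ge (l := l) (m := m) (T := T) 0 i
  by_contra hne
  have h2 := gN_le (l := l) (m := m) (T := T) 0 i
  have hs : InSkew l m (i, min (m i) (l i)) := by simp only [InSkew]; omega
  have h3 := (gN_iff h (k := 0) hs).mp (by omega)
  exact (h.support _).mpr hs (by simp only; omega)

lemma gN_mono (h : IsLR l m n T) (k i : ℕ) : gN l m T k i ≤ gN l m T (k + 1) i := by
  by_contra hlt
  have h1 := gN_ge (l := l) (m := m) (T := T) (k + 1) i
  have h2 := gN_le (l := l) (m := m) (T := T) k i
  have hs : InSkew l m (i, gN l m T (k + 1) i) := by simp only [InSkew]; omega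
  have h3 := (gN_iff h (k := k) hs).mp (by omega)
  have h4 := (gN_iff h (k := k + 1) hs).mpr (by omega)
  omega

lemma gN_inter (hl : IsPartition l) (hm : IsPartition m) (h : IsLR l m n T) (k i : ℕ) :
    gN l m T (k + 1) (i + 1) ≤ gN l m T k i := by
  by_contra hlt
  have h1 := gN_ge (l := l) (m := m) (T := T) k i
  have h2 := gN_le (l := l) (m := m) (T := T) (k + 1) (i + 1)
  have e1 := hl.1 (Nat.le_succ i)
  have e2 := hm.1 (Nat.le_succ i)
  simp only [Nat.succ_eq_add_one] at e1 e2
  have hs : InSkew l m (i, gN l m T k i) := by simp only [InSkew]; omega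
  have hs' : InSkew l m (i + 1, gN l m T k i) := by simp only [InSkew] at *; omega
  have h3 := (gN_iff h (k := k + 1) hs').mp (by omega)
  have h4 := (gN_iff h (k := k) hs).not.mp (by omega)
  have := h.col_strict i _ hs hs'
  omega

lemma skew_finite (hl : IsPartition l) : {p : ℕ × ℕ | InSkew l m p}.Finite := by
  obtain ⟨N, hN⟩ := hl.2
  apply Set.Finite.subset (Finset.finite_toSet (Finset.range N ×ˢ Finset.range (l 0)))
  rintro ⟨i, c⟩ hp
  simp only [Set.mem_ofPred_eq, InSkew] at hp
  have := hl.1 (Nat.zero_le i)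
  simp only [Finset.coe_product, Finset.coe_range, Set.mem_prod, Set.mem_Iio]
  refine ⟨?_, by omega⟩
  by_contra hi
  have := hN i (by omega)
  omega

lemma T_le (hl : IsPartition l) (h : IsLR l m n T) {L : ℕ} (hL : ∀ k, L ≤ k → n k = 0) (i c : ℕ) :
    T i c ≤ L := by
  by_contra hlt
  obtain ⟨k, hk⟩ : ∃ k, T i c = k + 1 := ⟨T i c - 1, by omega⟩
  have h1 := h.content k
  rw [hL k (by omega)] at h1
  have hfin : Finite {p : ℕ × ℕ // T p.1 p.2 = k + 1} := by
    apply Set.finite_coe_iff.mpr ((skew_finite (m := m) hl).subset _)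
    intro p hp
    simp only [Set.mem_ofPred_eq] at hp ⊢
    exact (h.support p).mp (by rw [hp]; omega)
  rw [Finite.card_eq_zero_iff] at h1
  exact h1.elim ⟨(i, c), hk⟩

lemma gZ_isArr (hl : IsPartition l) (hm : IsPartition m) (h : IsLR l m n T) {L : ℕ}
    (hL : ∀ k, L ≤ k → n k = 0) : IsArr L (mZ l m) (lZ l) (gZ l m T) := by
  refine ⟨?_, ?_, ?_, ?_⟩
  · funext i
    rcases int_cases i with ⟨r, rfl⟩ | hi
    · rw [gZ_nat, mZ_nat, gN_zero h]
    · rw [gZ_neg _ hi, mZ_neg l m hi]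
  · intro k hk
    funext i
    rcases int_cases i with ⟨r, rfl⟩ | hi
    · rw [gZ_nat, lZ_nat]
      congr 1
      apply le_antisymm (gN_le k r)
      by_contra hlt
      have h1 := gN_ge (l := l) (m := m) (T := T) k r
      have hs : InSkew l m (r, gN l m T k r) := by simp only [InSkew]; omega
      have := (gN_iff h (k := k) hs).mpr ((T_le hl h hL _ _).trans hk)
      omega
    · rw [gZ_neg _ hi, lZ_neg l hi]
  · intro k i
    rcases int_cases i with ⟨r, rfl⟩ | hi
    · rw [gZ_nat, gZ_nat]; exact_mod_cast gN_mono h k r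
    · rw [gZ_neg _ hi, gZ_neg _ hi]
  · intro k i
    rcases int_cases i with ⟨r, rfl⟩ | hi
    · rw [show (r : ℤ) + 1 = ((r + 1 : ℕ) : ℤ) by push_cast; rfl, gZ_nat, gZ_nat]
      exact_mod_cast gN_inter hl hm h k r
    · rw [gZ_neg _ hi]
      rcases int_cases (i + 1) with ⟨r, hr⟩ | hi
      · rw [hr, gZ_nat]
        have := hl.1 (Nat.zero_le r)
        have := gN_le (l := l) (m := m) (T := T) (k + 1) r
        omega
      · rw [gZ_neg _ hi]

lemma gZ_mem (hl : IsPartition l) (hm : IsPartition m) (h : IsLR l m n T) {L : ℕ}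
    (hL : ∀ k, L ≤ k → n k = 0) {B : ℤ} (hB : Good B (mZ l m) (lZ l))
    (hB0 : ∀ i, B ≤ i → lZ l i = 0) :
    gZ l m T ∈ colLR B L (mZ l m) (lZ l) (fun k => (n k : ℤ)) := by
  classical
  have hA := gZ_isArr hl hm h hL
  have hbig : ∀ k i, B ≤ i → gZ l m T k i = mZ l m i := fun k i hi =>
    hA.row_const (hB.high i hi) k
  have hm0 : ∀ i, 0 ≤ mZ l m i := by
    intro i
    rcases int_cases i with ⟨r, rfl⟩ | hi
    · rw [mZ_nat]; omega
    · rw [mZ_neg l m hi]; omega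
  simp only [colLR, Finset.mem_filter, mem_arrs hB]
  refine ⟨hA, ?_, ?_⟩
  · apply yam_of_row hA hB hm0 hB0
    · intro k i hi
      obtain ⟨r, rfl⟩ : ∃ r : ℕ, i = r := ⟨i.toNat, by omega⟩
      have hlat := h.lattice r (gN l m T (k + 1) r) k
      have c1 := card_region B (fun i => if i ≤ r then gZ l m T (k + 1) i else 0)
        (fun i => if i ≤ r then gZ l m T (k + 2) i else 0)
        (by intro i _; have := hA.bounds (k + 1) i; have := hm0 i; split_ifs <;> omega)
        (by
          intro i
          have := hA.mono (k + 1) i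
          rw [show k + 1 + 1 = k + 2 from rfl] at this
          split_ifs <;> omega)
        (by intro i hi; simp only [gZ_neg _ hi])
        (by intro i hi; simp only [hbig _ i hi])
      have c2 := card_region B (fun i => if i < r then gZ l m T k i else 0)
        (fun i => if i < r then gZ l m T (k + 1) i else 0)
        (by intro i _; have := hA.bounds k i; have := hm0 i; split_ifs <;> omega)
        (by intro i; have := hA.mono k i; split_ifs <;> omega)
        (by intro i hi; simp only [gZ_neg _ hi])
        (by intro i hi; simp only [hbig _ i hi])
      have d1 : ∀ p : ℕ × ℕ, (T p.1 p.2 = k + 2 ∧ (p.1 < r ∨ (p.1 = r ∧ gN l m T (k + 1) r ≤ p.2))) ↔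
          ((if (p.1 : ℤ) ≤ r then gZ l m T (k + 1) p.1 else 0) ≤ (p.2 : ℤ) ∧
          (p.2 : ℤ) < (if (p.1 : ℤ) ≤ r then gZ l m T (k + 2) p.1 else 0)) := by
        rintro ⟨i, c⟩
        simp only
        rw [T_eq_iff h (k + 1) i c]
        rw [gZ_nat, gZ_nat, show k + 1 + 1 = k + 2 from rfl]
        rcases lt_trichotomy i r with hir | hir | hir
        · rw [if_pos (by omega), if_pos (by omega)]; omega
        · subst hir; rw [if_pos (by omega), if_pos (by omega)]; omega
        · rw [if_neg (by omega), if_neg (by omega)]; omega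
      have d2 : ∀ p : ℕ × ℕ, (T p.1 p.2 = k + 1 ∧ (p.1 < r ∨ (p.1 = r ∧ gN l m T (k + 1) r ≤ p.2))) ↔
          ((if (p.1 : ℤ) < r then gZ l m T k p.1 else 0) ≤ (p.2 : ℤ) ∧
          (p.2 : ℤ) < (if (p.1 : ℤ) < r then gZ l m T (k + 1) p.1 else 0)) := by
        rintro ⟨i, c⟩
        simp only
        rw [T_eq_iff h k i c]
        rw [gZ_nat, gZ_nat]
        rcases lt_trichotomy i r with hir | hir | hir
        · rw [if_pos (by omega), if_pos (by omega)]; omega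
        · subst hir; rw [if_neg (by omega), if_neg (by omega)]; omega
        · rw [if_neg (by omega), if_neg (by omega)]; omega
      simp only [d1, d2] at hlat
      have hlat' : ((Nat.card _ : ℕ) : ℤ) ≤ ((Nat.card _ : ℕ) : ℤ) := Int.ofNat_le.mpr hlat
      rw [c1, c2] at hlat'
      refine le_trans (le_of_eq ?_) (hlat'.trans (le_of_eq ?_))
      · apply Finset.sum_congr rfl; intro i _; split_ifs <;> simp
      · apply Finset.sum_congr rfl; intro i _; split_ifs <;> simp
    · intro k i hi
      rw [gZ_neg _ hi, gZ_neg _ hi]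
  · intro k
    have hc := h.content k
    have c1 := card_region B (gZ l m T k) (gZ l m T (k + 1))
        (by intro i _; have := hA.bounds k i; have := hm0 i; omega)
        (by intro i; exact hA.mono k i)
        (by intro i hi; rw [gZ_neg _ hi, gZ_neg _ hi])
        (by intro i hi; rw [hbig _ i hi, hbig _ i hi])
    have d : ∀ p : ℕ × ℕ, T p.1 p.2 = k + 1 ↔
        (gZ l m T k p.1 ≤ (p.2 : ℤ) ∧ (p.2 : ℤ) < gZ l m T (k + 1) p.1) := by
      rintro ⟨i, c⟩
      simp only
      rw [T_eq_iff h k i c, gZ_nat, gZ_nat]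
      omega
    simp only [d] at hc
    rw [← hc, c1]
    rfl

lemma gZ_inj {T' : ℕ → ℕ → ℕ} (h : IsLR l m n T) (h' : IsLR l m n T')
    (he : gZ l m T = gZ l m T') : T = T' := by
  have hN : ∀ k i, gN l m T k i = gN l m T' k i := by
    intro k i
    have := congrFun (congrFun he k) i
    rw [gZ_nat, gZ_nat] at this
    exact_mod_cast this
  funext i c
  by_cases hc : InSkew l m (i, c)
  · have a1 := (gN_iff h (k := T i c) hc).mpr le_rfl
    have a2 := (gN_iff h' (k := T' i c) hc).mpr le_rfl
    rw [hN, gN_iff h' hc] at a1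
    rw [← hN, gN_iff h hc] at a2
    omega
  · have h0 := (h.support (i, c)).not.mpr hc
    have h1 := (h'.support (i, c)).not.mpr hc
    simp only [not_not] at h0 h1
    rw [h0, h1]

lemma LR_le (hl : IsPartition l) (hm : IsPartition m) {L : ℕ}
    (hL : ∀ k, L ≤ k → n k = 0) {B : ℤ} (hB : Good B (mZ l m) (lZ l))
    (hB0 : ∀ i, B ≤ i → lZ l i = 0) :
    Finite {T : ℕ → ℕ → ℕ // IsLR l m n T} ∧
    LR l m n ≤ (colLR B L (mZ l m) (lZ l) (fun k => (n k : ℤ))).card := by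
  let F : {T : ℕ → ℕ → ℕ // IsLR l m n T} →
      (colLR B L (mZ l m) (lZ l) (fun k => (n k : ℤ))) :=
    fun T => ⟨gZ l m T.1, gZ_mem hl hm T.2 hL hB hB0⟩
  have hF : Function.Injective F := by
    intro T T' he
    exact Subtype.ext (gZ_inj T.2 T'.2 (congrArg Subtype.val he))
  refine ⟨Finite.of_injective F hF, ?_⟩
  have := Nat.card_le_card_of_injective F hF
  rwa [Nat.card_eq_fintype_card (α := (colLR B L (mZ l m) (lZ l) (fun k => (n k : ℤ)))),
    Fintype.card_coe] at this

end
end LRC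

namespace LRC

open Classical in
/-- number of cells of `A` with `U`-entry `t` in columns `≤ j` -/
noncomputable def cU (A : Finset (ℕ × ℕ)) (U : ℕ → ℕ → ℕ) (t j : ℕ) : ℕ :=
  (A.filter (fun p => U p.1 p.2 = t ∧ p.2 ≤ j)).card

open Classical in
/-- Reverse (rotated) column LR tableaux on `A`. -/
structure Rev (n : ℕ → ℕ) (A : Finset (ℕ × ℕ)) (U : ℕ → ℕ → ℕ) : Prop where
  support : ∀ p : ℕ × ℕ, U p.1 p.2 ≠ 0 ↔ p ∈ A
  row : ∀ i j, (i, j) ∈ A → (i, j + 1) ∈ A → U i (j + 1) ≤ U i j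
  col : ∀ i i' j, (i, j) ∈ A → (i', j) ∈ A → i < i' → U i' j < U i j
  content : ∀ k, (A.filter (fun p => U p.1 p.2 = k + 1)).card = n k
  latt : ∀ j k, cU A U (k + 2) j ≤ cU A U (k + 1) j

open Classical in
/-- The companion, at the untransposed position. -/
noncomputable def comp (A : Finset (ℕ × ℕ)) (U : ℕ → ℕ → ℕ) (p : ℕ × ℕ) : ℕ :=
  if p ∈ A then cU A U (U p.1 p.2) p.2 else 0

section
variable {n : ℕ → ℕ} {A : Finset (ℕ × ℕ)} {U : ℕ → ℕ → ℕ}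

lemma cU_mono (t : ℕ) {j j' : ℕ} (h : j ≤ j') : cU A U t j ≤ cU A U t j' := by
  apply Finset.card_le_card
  intro p hp
  simp only [Finset.mem_filter] at hp ⊢
  exact ⟨hp.1, hp.2.1, hp.2.2.trans h⟩

lemma cU_lt {p : ℕ × ℕ} (hp : p ∈ A) {j : ℕ} (h : j < p.2) :
    cU A U (U p.1 p.2) j < cU A U (U p.1 p.2) p.2 := by
  apply Finset.card_lt_card
  rw [Finset.ssubset_iff_of_subset]
  · refine ⟨p, ?_, ?_⟩
    · simp [hp]
    · simp only [Finset.mem_filter]; omega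
  · intro q hq
    simp only [Finset.mem_filter] at hq ⊢
    exact ⟨hq.1, hq.2.1, by omega⟩

lemma Rev.chain (h : Rev n A U) (j : ℕ) {a b : ℕ} (hb : 1 ≤ b) (hab : b ≤ a) :
    cU A U a j ≤ cU A U b j := by
  induction a, hab using Nat.le_induction with
  | base => exact le_rfl
  | succ a hab ih =>
    refine le_trans ?_ ih
    obtain ⟨k, rfl⟩ : ∃ k, a = k + 1 := ⟨a - 1, by omega⟩
    exact h.latt j k

lemma Rev.pos (h : Rev n A U) {p : ℕ × ℕ} (hp : p ∈ A) : 1 ≤ U p.1 p.2 :=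
  Nat.one_le_iff_ne_zero.mpr ((h.support p).mpr hp)

lemma comp_pos {p : ℕ × ℕ} (hp : p ∈ A) : 1 ≤ comp A U p := by
  simp only [comp, if_pos hp, cU]
  apply Finset.card_pos.mpr
  exact ⟨p, by simp [hp]⟩

lemma Rev.uniq (h : Rev n A U) {p q : ℕ × ℕ} (hp : p ∈ A) (hq : q ∈ A)
    (hU : U p.1 p.2 = U q.1 q.2) (hC : comp A U p = comp A U q) : p = q := by
  simp only [comp, if_pos hp, if_pos hq] at hC
  have h2 : p.2 = q.2 := by
    rcases lt_trichotomy p.2 q.2 with hlt | he | hlt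
    · have := cU_lt (U := U) hq hlt
      rw [hU] at hC; omega
    · exact he
    · have := cU_lt (U := U) hp hlt
      rw [← hU] at hC; omega
  obtain ⟨i, j⟩ := p
  obtain ⟨i', j'⟩ := q
  simp only at h2 hU
  subst h2
  rcases lt_trichotomy i i' with hlt | he | hlt
  · have := h.col i i' j hp hq hlt; omega
  · rw [he]
  · have := h.col i' i j hq hp hlt; omega

open Classical in
lemma Rev.ex (h : Rev n A U) {t r : ℕ} (hr : 1 ≤ r)
    (hr' : r ≤ (A.filter (fun p => U p.1 p.2 = t)).card) :
    ∃ p ∈ A, U p.1 p.2 = t ∧ comp A U p = r := by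
  have himg : (A.filter (fun p => U p.1 p.2 = t)).image (comp A U) =
      Finset.Icc 1 (A.filter (fun p => U p.1 p.2 = t)).card := by
    apply Finset.eq_of_subset_of_card_le
    · intro x hx
      simp only [Finset.mem_image, Finset.mem_filter] at hx
      obtain ⟨p, ⟨hp, hU⟩, rfl⟩ := hx
      simp only [Finset.mem_Icc]
      refine ⟨comp_pos hp, ?_⟩
      simp only [comp, if_pos hp, cU]
      apply Finset.card_le_card
      intro q hq
      simp only [Finset.mem_filter] at hq ⊢
      exact ⟨hq.1, hq.2.1.trans hU⟩
    · rw [Finset.card_image_of_injOn, Nat.card_Icc]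
      · omega
      · intro p hp q hq he
        simp only [Finset.coe_filter, Set.mem_ofPred_eq] at hp hq
        exact h.uniq hp.1 hq.1 (hp.2.trans hq.2.symm) he
  have : r ∈ Finset.Icc 1 (A.filter (fun p => U p.1 p.2 = t)).card := by
    simp only [Finset.mem_Icc]; omega
  rw [← himg] at this
  simp only [Finset.mem_image, Finset.mem_filter] at this
  obtain ⟨p, ⟨hp, hU⟩, hC⟩ := this
  exact ⟨p, hp, hU, hC⟩

lemma Rev.ex2 (h : Rev n A U) {t r j : ℕ} (hr : 1 ≤ r) (hr' : r ≤ cU A U t j) :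
    ∃ p ∈ A, U p.1 p.2 = t ∧ comp A U p = r ∧ p.2 ≤ j := by
  classical
  obtain ⟨p, hp, hU, hC⟩ := h.ex hr (t := t) (hr'.trans (by
    apply Finset.card_le_card
    intro q hq
    simp only [Finset.mem_filter] at hq ⊢
    exact ⟨hq.1, hq.2.1⟩))
  refine ⟨p, hp, hU, hC, ?_⟩
  by_contra hlt
  have := cU_lt (U := U) hp (j := j) (by omega)
  simp only [comp, if_pos hp] at hC
  rw [hU] at hC this
  omega

lemma Rev.before (h : Rev n A U) {p : ℕ × ℕ} (hp : p ∈ A) {b : ℕ} (hb : 1 ≤ b)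
    (hbp : b < U p.1 p.2) : ∃ q ∈ A, U q.1 q.2 = b ∧ comp A U q = comp A U p ∧
      (q.2 < p.2 ∨ (q.2 = p.2 ∧ p.1 < q.1)) := by
  have hc : comp A U p = cU A U (U p.1 p.2) p.2 := by simp only [comp, if_pos hp]
  have h1 := h.chain p.2 hb hbp.le
  rw [← hc] at h1
  obtain ⟨q, hq, hU, hC, hle⟩ := h.ex2 (comp_pos hp) h1
  refine ⟨q, hq, hU, hC, ?_⟩
  rcases lt_or_eq_of_le hle with hlt | heq
  · exact Or.inl hlt
  · refine Or.inr ⟨heq, ?_⟩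
    obtain ⟨i, j⟩ := p
    obtain ⟨i', j'⟩ := q
    simp only at *
    subst heq
    by_contra hlt
    rcases lt_or_eq_of_le (not_lt.mp hlt) with h3 | h3
    · have := h.col i' i j' hq hp h3; omega
    · subst h3; omega

open Classical in
lemma Rev.recover (h : Rev n A U) {p : ℕ × ℕ} (hp : p ∈ A) :
    U p.1 p.2 = (A.filter (fun q => comp A U q = comp A U p ∧
      (q.2 < p.2 ∨ (q.2 = p.2 ∧ p.1 ≤ q.1)))).card := by
  have himg : (A.filter (fun q => comp A U q = comp A U p ∧
      (q.2 < p.2 ∨ (q.2 = p.2 ∧ p.1 ≤ q.1)))).image (fun q => U q.1 q.2) =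
      Finset.Icc 1 (U p.1 p.2) := by
    ext b
    simp only [Finset.mem_image, Finset.mem_filter, Finset.mem_Icc]
    constructor
    · rintro ⟨q, ⟨hq, hC, hpos⟩, rfl⟩
      refine ⟨h.pos hq, ?_⟩
      by_contra hlt
      obtain ⟨q', hq', hU', hC', hpos'⟩ := h.before hq (h.pos hp) (not_le.mp hlt)
      have := h.uniq hq' hp hU' (hC'.trans hC)
      subst this
      omega
    · rintro ⟨h1, h2⟩
      rcases lt_or_eq_of_le h2 with h3 | h3
      · obtain ⟨q', hq', hU', hC', hpos'⟩ := h.before hp h1 h3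
        exact ⟨q', ⟨hq', hC', by omega⟩, hU'⟩
      · exact ⟨p, ⟨hp, rfl, by omega⟩, h3.symm⟩
  have hcard := congrArg Finset.card himg
  rw [Finset.card_image_of_injOn, Nat.card_Icc] at hcard
  · omega
  · intro q hq q' hq' he
    simp only [Finset.coe_filter, Set.mem_ofPred_eq] at hq hq'
    exact h.uniq hq.1 hq'.1 he (hq.2.1.trans hq'.2.1.symm)

lemma Rev.inj {V : ℕ → ℕ → ℕ} (h : Rev n A U) (h' : Rev n A V)
    (he : ∀ p, comp A U p = comp A V p) : U = V := by
  classical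
  funext i j
  by_cases hp : (i, j) ∈ A
  · have h1 := h.recover hp
    have h2 := h'.recover hp
    simp only [he] at h1
    simp only at h1 h2
    rw [h1, h2]
  · have h1 := (h.support (i, j)).not.mpr hp
    have h2 := (h'.support (i, j)).not.mpr hp
    simp only [not_not] at h1 h2
    rw [h1, h2]

lemma comp_ne {p : ℕ × ℕ} : comp A U p ≠ 0 ↔ p ∈ A := by
  constructor
  · intro h
    by_contra hp
    exact h (by simp only [comp, if_neg hp])
  · intro hp
    have := comp_pos (U := U) hp
    omega

lemma Rev.isLR {l' m' : ℕ → ℕ} (h : Rev n A U)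
    (hA : ∀ i j, (i, j) ∈ A ↔ InSkew l' m' (j, i)) :
    IsLR l' m' (fun i => Nat.card {t : ℕ // i < n t}) (fun j i => comp A U (i, j)) := by
  classical
  refine ⟨?_, ?_, ?_, ?_, ?_⟩
  · rintro ⟨j, i⟩
    simp only
    rw [comp_ne, hA]
  · intro j i h1 h2
    rw [← hA] at h1 h2
    simp only [comp, if_pos h1, if_pos h2]
    exact h.chain j (h.pos h2) (h.col i (i + 1) j h1 h2 (by omega)).le
  · intro j i h1 h2
    rw [← hA] at h1 h2
    simp only [comp, if_pos h1, if_pos h2]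
    exact lt_of_le_of_lt (h.chain j (h.pos h2) (h.row i j h1 h2))
      (cU_lt (U := U) h2 (Nat.lt_succ_self j))
  · intro k
    have hmem : ∀ x : ℕ × ℕ, comp A U (x.2, x.1) = k + 1 → (x.2, x.1) ∈ A := by
      intro x hx
      exact comp_ne.mp (by rw [hx]; omega)
    apply Nat.card_congr
    refine Equiv.ofBijective (fun x => ⟨U x.1.2 x.1.1 - 1, ?_⟩) ⟨?_, ?_⟩
    · have hx := hmem x.1 x.2
      have hc := x.2
      have hpos := h.pos hx
      simp only [comp, if_pos hx] at hc hpos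
      have h1 := h.content (U x.1.2 x.1.1 - 1)
      rw [show U x.1.2 x.1.1 - 1 + 1 = U x.1.2 x.1.1 by omega] at h1
      rw [← h1]
      have : cU A U (U x.1.2 x.1.1) x.1.1 ≤
          (A.filter (fun p => U p.1 p.2 = U x.1.2 x.1.1)).card := by
        apply Finset.card_le_card
        intro q hq
        simp only [Finset.mem_filter] at hq ⊢
        exact ⟨hq.1, hq.2.1⟩
      omega
    · rintro ⟨⟨j, i⟩, hx⟩ ⟨⟨j', i'⟩, hx'⟩ he
      simp only [Subtype.mk.injEq] at he
      have m1 := hmem _ hx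
      have m2 := hmem _ hx'
      have p1 := h.pos m1
      have p2 := h.pos m2
      simp only at m1 m2 p1 p2 hx hx'
      have := h.uniq m1 m2 (by simp only; omega) (hx.trans hx'.symm)
      simp only [Prod.mk.injEq] at this
      simp [this.1, this.2]
    · rintro ⟨t, ht⟩
      rw [← h.content t] at ht
      obtain ⟨p, hp, hU, hC⟩ := h.ex (t := t + 1) (r := k + 1) (by omega) (by omega)
      refine ⟨⟨(p.2, p.1), hC⟩, ?_⟩
      simp only [Subtype.mk.injEq, hU]
      omega
  · intro J I k
    have hfin : Finite {x : ℕ × ℕ // comp A U (x.2, x.1) = k + 1 ∧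
        (x.1 < J ∨ (x.1 = J ∧ I ≤ x.2))} := by
      apply Finite.of_injective
        (β := A) (fun x => ⟨(x.1.2, x.1.1), comp_ne.mp (by rw [x.2.1]; omega)⟩)
      rintro ⟨⟨j, i⟩, hx⟩ ⟨⟨j', i'⟩, hx'⟩ he
      simp only [Subtype.mk.injEq, Prod.mk.injEq] at he
      simp [he.1, he.2]
    have hex : ∀ x : {x : ℕ × ℕ // comp A U (x.2, x.1) = k + 2 ∧
        (x.1 < J ∨ (x.1 = J ∧ I ≤ x.2))}, ∃ q ∈ A, U q.1 q.2 = U x.1.2 x.1.1 ∧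
        comp A U q = k + 1 ∧ q.2 < x.1.1 := by
      rintro ⟨⟨j, i⟩, hx, hpos⟩
      simp only at hx hpos ⊢
      have hp : (i, j) ∈ A := comp_ne.mp (by rw [hx]; omega)
      have hx2 := hx
      simp only [comp, if_pos hp] at hx2
      obtain ⟨q, hq, hU, hC, hle⟩ := h.ex2 (t := U i j) (r := k + 1) (j := j) (by omega) (by omega)
      refine ⟨q, hq, hU, hC, ?_⟩
      by_contra hlt
      have : q.2 = j := by omega
      simp only [comp, if_pos hq] at hC
      rw [hU, this] at hC
      omega
    choose q hqA hqU hqC hqlt using hex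
    apply Nat.card_le_card_of_injective (fun x => ⟨((q x).2, (q x).1), hqC x, by
      have := x.2.2
      have := hqlt x
      simp only
      omega⟩)
    intro x x' he
    simp only [Subtype.mk.injEq, Prod.mk.injEq] at he
    have hq : q x = q x' := Prod.ext he.2 he.1
    have m1 : (x.1.2, x.1.1) ∈ A := comp_ne.mp (by rw [x.2.1]; omega)
    have m2 : (x'.1.2, x'.1.1) ∈ A := comp_ne.mp (by rw [x'.2.1]; omega)
    have := h.uniq m1 m2 (by simp only; rw [← hqU, ← hqU, hq]) (x.2.1.trans x'.2.1.symm)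
    simp only [Prod.mk.injEq] at this
    exact Subtype.ext (Prod.ext this.2 this.1)

end

section
variable {l m n : ℕ → ℕ}

open Classical in
/-- the reverse tableau of a rotated array -/
noncomputable def toU (l m : ℕ → ℕ) (γ : ℕ → ℤ → ℤ) (i c : ℕ) : ℕ :=
  if InSkew l m (i, c) then sInf {k | 1 - γ k (-(i : ℤ)) ≤ c} else 0

lemma rot_bounds {L : ℕ} {γ : ℕ → ℤ → ℤ}
    (h : IsArr L (rotb (lZ l)) (rotb (mZ l m)) γ) (k i : ℕ) :
    ((min (m i) (l i) : ℕ) : ℤ) ≤ 1 - γ k (-(i : ℤ)) ∧ 1 - γ k (-(i : ℤ)) ≤ l i := by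
  have := h.bounds k (-(i : ℤ))
  simp only [rotb, neg_neg, lZ_nat, mZ_nat] at this
  omega

lemma toU_le_iff {L : ℕ} {γ : ℕ → ℤ → ℤ}
    (h : IsArr L (rotb (lZ l)) (rotb (mZ l m)) γ) {i c : ℕ} (hc : InSkew l m (i, c)) (k : ℕ) :
    toU l m γ i c ≤ k ↔ 1 - γ k (-(i : ℤ)) ≤ c := by
  have hne : {k | 1 - γ k (-(i : ℤ)) ≤ c}.Nonempty := by
    refine ⟨L, ?_⟩
    simp only [Set.mem_ofPred_eq]
    rw [h.top L le_rfl]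
    simp only [rotb, neg_neg, mZ_nat]
    simp only [InSkew] at hc
    omega
  simp only [toU, if_pos hc]
  constructor
  · intro hle
    have h1 := Nat.sInf_mem hne
    simp only [Set.mem_ofPred_eq] at h1
    have hm : Monotone (fun k => γ k (-(i : ℤ))) := monotone_nat_of_le_succ (fun k => h.mono k _)
    have := hm hle
    simp only at this
    omega
  · intro hle
    exact Nat.sInf_le hle

lemma toU_eq_iff {L : ℕ} {γ : ℕ → ℤ → ℤ}
    (h : IsArr L (rotb (lZ l)) (rotb (mZ l m)) γ) (i c k : ℕ) :
    toU l m γ i c = k + 1 ↔ 1 - γ (k + 1) (-(i : ℤ)) ≤ c ∧ (c : ℤ) < 1 - γ k (-(i : ℤ)) := by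
  by_cases hc : InSkew l m (i, c)
  · have h1 := toU_le_iff h hc k
    have h2 := toU_le_iff h hc (k + 1)
    omega
  · have h1 := rot_bounds h k i
    have h2 := rot_bounds h (k + 1) i
    have h3 : toU l m γ i c = 0 := by simp only [toU, if_neg hc]
    simp only [InSkew] at hc
    omega

lemma toU_pos {L : ℕ} {γ : ℕ → ℤ → ℤ}
    (h : IsArr L (rotb (lZ l)) (rotb (mZ l m)) γ) (i c : ℕ) :
    toU l m γ i c ≠ 0 ↔ InSkew l m (i, c) := by
  constructor
  · intro h1
    by_contra hc
    exact h1 (by simp only [toU, if_neg hc])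
  · intro hc h0
    have := (toU_le_iff h hc 0).mp (by omega)
    rw [h.zero] at this
    simp only [rotb, neg_neg, lZ_nat] at this
    simp only [InSkew] at hc
    omega

lemma toU_rev {L : ℕ} {γ : ℕ → ℤ → ℤ} {B : ℤ} {A : Finset (ℕ × ℕ)}
    (hA : ∀ p, p ∈ A ↔ InSkew l m p)
    (hl : IsPartition l) (hL : ∀ k, L ≤ k → n k = 0)
    (hB : Good B (mZ l m) (lZ l))
    (hγ : γ ∈ colLR B L (rotb (lZ l)) (rotb (mZ l m)) (fun k => (n k : ℤ))) :
    Rev n A (toU l m γ) := by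
  classical
  have hB' := hB.rot (lZ_anti hl)
  simp only [colLR, Finset.mem_filter, mem_arrs hB'] at hγ
  obtain ⟨h, hY, hC⟩ := hγ
  have hneg : ∀ k i, i < 0 → γ k (-i) = 1 - l 0 := by
    intro k i hi
    rw [h.row_const]
    · simp only [rotb, neg_neg, lZ_neg l hi]
    · simp only [rotb, neg_neg, lZ_neg l hi, mZ_neg l m hi]
  have hbig : ∀ k i, B ≤ i → γ k (-i) = γ 0 (-i) := by
    intro k i hi
    have : rotb (lZ l) (-i) = rotb (mZ l m) (-i) := by
      simp only [rotb, neg_neg, hB.high i hi]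
    rw [h.row_const this, h.row_const this]
  have hcount : ∀ k j : ℕ, (cU A (toU l m γ) (k + 1) j : ℤ) = cntN B γ k (-(j : ℤ)) := by
    intro k j
    have c := card_region B (fun i => min (1 - γ (k + 1) (-i)) (j + 1))
      (fun i => min (1 - γ k (-i)) (j + 1))
      (by
        intro i hi
        obtain ⟨r, rfl⟩ : ∃ r : ℕ, i = r := ⟨i.toNat, by omega⟩
        have := rot_bounds h (k + 1) r
        omega)
      (by intro i; have := h.mono k (-i); omega)
      (by intro i hi; simp only [hneg _ i hi])
      (by intro i hi; simp only [hbig k i hi, hbig (k + 1) i hi])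
    rw [Nat.subtype_card (A.filter (fun p => toU l m γ p.1 p.2 = k + 1 ∧ p.2 ≤ j))] at c
    · unfold cU
      rw [c, cntN, ← sum_neg_Icc B (fun i => max (γ (k + 1) i) (-(j : ℤ)) - max (γ k i) (-(j : ℤ)))]
      apply Finset.sum_congr rfl
      intro i _
      omega
    · rintro ⟨i, c⟩
      simp only [Finset.mem_filter, hA]
      rw [← toU_pos h, toU_eq_iff h]
      have h2 := toU_eq_iff h i c k
      omega
  refine ⟨?_, ?_, ?_, ?_, ?_⟩
  · rintro ⟨i, c⟩
    rw [hA]; exact toU_pos h i c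
  · intro i j h1 h2
    rw [hA] at h1 h2
    rw [toU_le_iff h h2]
    have := (toU_le_iff h h1 _).mp le_rfl
    push_cast
    omega
  · intro i i' j h1 h2 hlt
    rw [hA] at h1 h2
    obtain ⟨t, ht⟩ : ∃ t, toU l m γ i j = t + 1 :=
      ⟨toU l m γ i j - 1, by have := (toU_pos h i j).mpr h1; omega⟩
    rw [ht, Nat.lt_succ_iff, toU_le_iff h h2]
    have e1 := (toU_le_iff h h1 (t + 1)).mp ht.le
    have e2 := h.antitone hB' t (show -(i' : ℤ) ≤ -(i : ℤ) - 1 by omega)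
    have e3 := h.inter' t (-(i : ℤ))
    omega
  · intro k
    have hkey : ((A.filter (fun p => toU l m γ p.1 p.2 = k + 1)).card : ℤ) =
        cnt B γ k := by
      have := hcount k B.toNat
      rw [show (-(B.toNat : ℤ)) = -B by have := hB.pos; omega, cntN_low h hB'] at this
      rw [← this]
      unfold cU
      congr 2
      apply Finset.filter_congr
      rintro ⟨i, c⟩ hp
      rw [hA] at hp
      simp only [InSkew] at hp
      have := hB.ub i
      rw [lZ_nat] at this
      simp only
      omega
    by_cases hk : k < L
    · have := hC ⟨k, hk⟩
      simp only at this
      rw [this] at hkey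
      exact_mod_cast hkey
    · have h0 : cnt B γ k = 0 := by
        rw [← cntN_low h hB', cntN_top h (by omega)]
      rw [h0] at hkey
      rw [hL k (by omega)]
      exact_mod_cast hkey
  · intro j k
    have := hY (-(j : ℤ)) k
    have e1 := hcount k j
    have e2 := hcount (k + 1) j
    rw [show k + 1 + 1 = k + 2 from rfl] at e2
    omega

lemma toU_inj {L : ℕ} {γ γ' : ℕ → ℤ → ℤ}
    (h : IsArr L (rotb (lZ l)) (rotb (mZ l m)) γ) (h' : IsArr L (rotb (lZ l)) (rotb (mZ l m)) γ')
    (he : toU l m γ = toU l m γ') : γ = γ' := by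
  have key : ∀ γ γ' : ℕ → ℤ → ℤ, IsArr L (rotb (lZ l)) (rotb (mZ l m)) γ →
      IsArr L (rotb (lZ l)) (rotb (mZ l m)) γ' → toU l m γ = toU l m γ' →
      ∀ k i : ℕ, 1 - γ' k (-(i : ℤ)) ≤ 1 - γ k (-(i : ℤ)) := by
    intro γ γ' h h' he k i
    by_contra hlt
    have b1 := rot_bounds h k i
    have b2 := rot_bounds h' k i
    obtain ⟨c, hc⟩ : ∃ c : ℕ, 1 - γ k (-(i : ℤ)) = c := ⟨(1 - γ k (-(i : ℤ))).toNat, by omega⟩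
    have hs : InSkew l m (i, c) := by simp only [InSkew]; omega
    have e1 := (toU_le_iff h hs k).mpr hc.le
    rw [he, toU_le_iff h' hs] at e1
    omega
  funext k i
  rcases int_cases (-i) with ⟨r, hr⟩ | hi
  · have e1 := key γ γ' h h' he k r
    have e2 := key γ' γ h' h he.symm k r
    rw [← hr, neg_neg] at e1 e2
    omega
  · have : rotb (lZ l) i = rotb (mZ l m) i := by
      simp only [rotb, lZ_neg l hi, mZ_neg l m hi]
    rw [h.row_const this, h'.row_const this]

/-- conjugate partition -/
noncomputable def conj (l : ℕ → ℕ) : ℕ → ℕ := fun i => Nat.card {j : ℕ // i < l j}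

lemma lt_conj (hl : IsPartition l) (i j : ℕ) : i < conj l j ↔ j < l i := by
  classical
  have hex : ∃ N, l N ≤ j := by
    obtain ⟨N, hN⟩ := hl.2
    exact ⟨N, by rw [hN N le_rfl]; omega⟩
  have hiff : ∀ i, i < Nat.find hex ↔ j < l i := by
    intro i
    constructor
    · intro h
      have := Nat.find_min hex h
      omega
    · intro h
      by_contra hle
      have h1 := Nat.find_spec hex
      have h2 := hl.1 (not_lt.mp hle)
      omega
  have : conj l j = Nat.find hex := by
    unfold conj
    rw [Nat.subtype_card (Finset.range (Nat.find hex)), Finset.card_range]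
    intro x
    rw [Finset.mem_range]
    exact hiff x
  rw [this]
  exact hiff i

lemma conj_part (hl : IsPartition l) : IsPartition (conj l) := by
  constructor
  · intro i j hij
    by_contra hlt
    have h1 := (lt_conj hl (conj l i) j).mp (not_le.mp hlt)
    have h2 := (lt_conj hl (conj l i) i).mpr (by omega)
    omega
  · refine ⟨l 0, fun i hi => ?_⟩
    by_contra h
    have := (lt_conj hl 0 i).mp (by omega)
    omega

lemma conj_conj (hl : IsPartition l) : conj (conj l) = l := by
  funext i
  apply le_antisymm
  · by_contra hlt
    have h1 := (lt_conj (conj_part hl) (l i) i).mp (by omega)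
    rw [lt_conj hl] at h1
    omega
  · by_contra hlt
    have h1 := (lt_conj (conj_part hl) (conj (conj l) i) i).mpr (by
      rw [lt_conj hl]; omega)
    omega

lemma LR_le_conj (hl : IsPartition l) (hm : IsPartition m) (hn : IsPartition n) :
    LR l m n ≤ LR (conj l) (conj m) (conj n) := by
  obtain ⟨L, hL⟩ := hn.2
  obtain ⟨B, hB, hB0⟩ := good_ext hl hm
  obtain ⟨L', hL'⟩ := (conj_part hn).2
  obtain ⟨B', hB', hB0'⟩ := good_ext (conj_part hl) (conj_part hm)
  have hfin := (LR_le (conj_part hl) (conj_part hm) hL' hB' hB0').1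
  refine (LR_le hl hm hL hB hB0).2.trans ?_
  rw [colLR_rot hB (lZ_anti hl) _ (by
    intro k; exact_mod_cast hn.1 (Nat.le_succ k))]
  have hB2 := hB.rot (lZ_anti hl)
  let A : Finset (ℕ × ℕ) := (skew_finite (m := m) hl).toFinset
  have hA : ∀ p, p ∈ A ↔ InSkew l m p := by intro p; simp [A]
  have hA' : ∀ i j, (i, j) ∈ A ↔ InSkew (conj l) (conj m) (j, i) := by
    intro i j
    rw [hA]
    have h1 := lt_conj hl i j
    have h2 := lt_conj hm i j
    simp only [InSkew]
    omega
  let F : (colLR B L (rotb (lZ l)) (rotb (mZ l m)) (fun k => (n k : ℤ))) →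
      {T : ℕ → ℕ → ℕ // IsLR (conj l) (conj m) (conj n) T} := fun γ =>
    ⟨fun j i => comp A (toU l m γ.1) (i, j), (toU_rev hA hl hL hB γ.2).isLR hA'⟩
  have hF : Function.Injective F := by
    intro γ γ' he
    have he' := congrArg Subtype.val he
    apply Subtype.ext
    have g1 := γ.2
    have g2 := γ'.2
    simp only [colLR, Finset.mem_filter, mem_arrs hB2] at g1 g2
    apply toU_inj g1.1 g2.1
    apply (toU_rev hA hl hL hB γ.2).inj (toU_rev hA hl hL hB γ'.2)
    rintro ⟨i, j⟩
    exact congrFun (congrFun he' j) i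
  have := Nat.card_le_card_of_injective F hF
  rwa [Nat.card_eq_fintype_card, Fintype.card_coe] at this

end
end LRC

theorem stmt15 (l m n : ℕ → ℕ) (hl : IsPartition l) (hm : IsPartition m)
    (hn : IsPartition n) :
    LR (fun i => Nat.card {j : ℕ // i < l j})
        (fun i => Nat.card {j : ℕ // i < m j})
        (fun i => Nat.card {j : ℕ // i < n j}) = LR l m n := by
  change LR (LRC.conj l) (LRC.conj m) (LRC.conj n) = LR l m n
  apply le_antisymm
  · have := LRC.LR_le_conj (LRC.conj_part hl) (LRC.conj_part hm) (LRC.conj_part hn)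
    rwa [LRC.conj_conj hl, LRC.conj_conj hm, LRC.conj_conj hn] at this
  · exact LRC.LR_le_conj hl hm hn
end

section
/- The maximal Durfee size d over all partitions η ⊆ (k^l) with c(η; μ, ν) ≠ 0 (the Durfee size of the Schubert product [μ] ⋆_{(k^l)} [ν]) equals the Durfee size of the cover partition C([μ] ⋆_{(k^l)} [ν]), which by the cover-partition theorem equals the largest d such that the box (l+1−d, k+1−d) is not in the base partition B([A]) of the associated skew diagram A = (((k^l)/μ)°)/ν, i.e., d = max{ d : B([A])_{l+1−d} ≤ k − d }. -/
/-- The base partition of the skew character `[l / m]`: componentwise minimum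
of all partitions appearing in it. -/
noncomputable def SkewBase (l m : ℕ → ℕ) (i : ℕ) : ℕ :=
  sInf {x | ∃ c, IsPartition c ∧ LR l m c ≠ 0 ∧ c i = x}

/-- Number of entries `v + 1` in the first `R` rows. -/
def cnt (s : ℕ → ℕ → ℕ) (v R : ℕ) : ℕ := ∑ r ∈ Finset.range R, (s (v + 1) r - s v r)

/-- Chain-of-shapes encoding of an LR tableau. -/
structure LRData (L : ℕ) (l m n : ℕ → ℕ) (s : ℕ → ℕ → ℕ) : Prop where
  zero : ∀ r, s 0 r = m r
  mono : ∀ v r, s v r ≤ s (v + 1) r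
  strip : ∀ v r, s (v + 1) (r + 1) ≤ s v r
  top : ∀ v r, r < v → s v r = l r
  latt : ∀ v R, cnt s (v + 1) (R + 1) ≤ cnt s v R
  cont : ∀ v, cnt s v L = n v

lemma cnt_succ (s : ℕ → ℕ → ℕ) (v R : ℕ) :
    cnt s v (R + 1) = cnt s v R + (s (v + 1) R - s v R) := by
  simp [cnt, Finset.sum_range_succ]

lemma cnt_zero (s : ℕ → ℕ → ℕ) (v : ℕ) : cnt s v 0 = 0 := by simp [cnt]

lemma LRData.le {L l m n s} (h : LRData L l m n s) {v w : ℕ} (hvw : v ≤ w) (r : ℕ) :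
    s v r ≤ s w r :=
  monotone_nat_of_le_succ (f := fun v => s v r) (fun v => h.mono v r) hvw

lemma LRData.le_top {L l m n s} (h : LRData L l m n s) (v r : ℕ) : s v r ≤ l r := by
  have h1 := h.le (le_max_left v (r + 1)) r
  rwa [h.top (max v (r + 1)) r (by omega)] at h1

lemma LRData.inner_le {L l m n s} (h : LRData L l m n s) (r : ℕ) : m r ≤ l r := by
  have := h.le_top 0 r
  rwa [h.zero] at this

lemma card_rows (Q : ℕ × ℕ → Prop) (N : ℕ) (a b : ℕ → ℕ)
    (hQ : ∀ p, Q p ↔ p.1 < N ∧ a p.1 ≤ p.2 ∧ p.2 < b p.1) :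
    Nat.card {p // Q p} = ∑ r ∈ Finset.range N, (b r - a r) := by
  have := Nat.subtype_card (p := Q)
    (((Finset.range N).sigma (fun r => Finset.Ico (a r) (b r))).map
      (Equiv.sigmaEquivProd ℕ ℕ).toEmbedding) (by
        rintro ⟨r, x⟩
        rw [hQ]
        simp)
  rw [this]
  simp

lemma card_prefix {T : ℕ → ℕ → ℕ} {s : ℕ → ℕ → ℕ}
    (hT : ∀ r x v, T r x = v + 1 ↔ s v r ≤ x ∧ x < s (v + 1) r) (v i j : ℕ) :
    Nat.card {p : ℕ × ℕ // T p.1 p.2 = v + 1 ∧ (p.1 < i ∨ (p.1 = i ∧ j ≤ p.2))} =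
      cnt s v i + (s (v + 1) i - max (s v i) j) := by
  rw [card_rows _ (i + 1) (fun r => if r = i then max (s v i) j else s v r)
    (fun r => s (v + 1) r)]
  · rw [Finset.sum_range_succ, cnt]
    simp only [if_true]
    congr 1
    apply Finset.sum_congr rfl
    intro r hr
    have : r ≠ i := by simp at hr; omega
    simp [this]
  · rintro ⟨r, x⟩
    simp only [hT]
    by_cases h : r = i
    · subst h; simp; omega
    · simp [h]; omega

lemma card_all {T : ℕ → ℕ → ℕ} {s : ℕ → ℕ → ℕ}
    (hT : ∀ r x v, T r x = v + 1 ↔ s v r ≤ x ∧ x < s (v + 1) r) (L v : ℕ)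
    (hL : ∀ r, L ≤ r → s (v + 1) r = 0) :
    Nat.card {p : ℕ × ℕ // T p.1 p.2 = v + 1} = cnt s v L := by
  rw [card_rows _ L (fun r => s v r) (fun r => s (v + 1) r)]
  · rfl
  · rintro ⟨r, x⟩
    simp only [hT]
    constructor
    · intro h
      refine ⟨?_, h⟩
      by_contra hr
      have := hL r (by omega)
      omega
    · exact fun h => h.2

lemma LRData.exists_isLR {L l m n s} (h : LRData L l m n s) (hl : ∀ r, L ≤ r → l r = 0) :
    ∃ T, IsLR l m n T := by
  have hex : ∀ r x, ∃ t, ∀ v, t = v + 1 ↔ s v r ≤ x ∧ x < s (v + 1) r := by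
    intro r x
    by_cases hv : ∃ v, s v r ≤ x ∧ x < s (v + 1) r
    · obtain ⟨v, hv1, hv2⟩ := hv
      refine ⟨v + 1, fun w => ⟨fun hw => ?_, fun hw => ?_⟩⟩
      · have : v = w := by omega
        subst this; exact ⟨hv1, hv2⟩
      · rcases lt_trichotomy v w with hlt | heq | hlt
        · have := h.le (show v + 1 ≤ w by omega) r
          omega
        · omega
        · have := h.le (show w + 1 ≤ v by omega) r
          omega
    · refine ⟨0, fun w => ⟨fun hw => by omega, fun hw => (hv ⟨w, hw⟩).elim⟩⟩
  choose T hT using hex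
  have hsupp : ∀ r x, T r x ≠ 0 ↔ m r ≤ x ∧ x < l r := by
    intro r x
    constructor
    · intro hne
      obtain ⟨v, hv⟩ := Nat.exists_eq_succ_of_ne_zero hne
      have := (hT r x v).1 hv
      have h1 := h.le (Nat.zero_le v) r
      rw [h.zero] at h1
      have h2 := h.le_top (v + 1) r
      omega
    · rintro ⟨h1, h2⟩ h0
      have key : ∀ v, s v r ≤ x := by
        intro v
        induction v with
        | zero => rw [h.zero]; exact h1
        | succ v ih =>
          by_contra hc
          have := (hT r x v).2 ⟨ih, by omega⟩
          omega
      have := key (r + 1)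
      rw [h.top _ _ (by omega)] at this
      omega
  refine ⟨T, ⟨fun p => hsupp p.1 p.2, ?_, ?_, ?_, ?_⟩⟩
  · intro i j h1 h2
    obtain ⟨a, ha⟩ := Nat.exists_eq_succ_of_ne_zero ((hsupp i j).2 h1)
    obtain ⟨b, hb⟩ := Nat.exists_eq_succ_of_ne_zero ((hsupp i (j + 1)).2 h2)
    by_contra hc
    have h3 := (hT _ _ _).1 ha
    have h4 := (hT _ _ _).1 hb
    have := h.le (show b + 1 ≤ a by omega) i
    omega
  · intro i j h1 h2
    obtain ⟨a, ha⟩ := Nat.exists_eq_succ_of_ne_zero ((hsupp i j).2 h1)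
    obtain ⟨b, hb⟩ := Nat.exists_eq_succ_of_ne_zero ((hsupp (i + 1) j).2 h2)
    by_contra hc
    have h3 := (hT _ _ _).1 ha
    have h4 := (hT _ _ _).1 hb
    have h5 := h.le (show b ≤ a by omega) i
    have h6 := h.strip b i
    omega
  · intro v
    rw [card_all hT L v, h.cont]
    intro r hr
    have := h.le_top (v + 1) r
    rw [hl r hr] at this
    omega
  · intro i j v
    rw [card_prefix hT v i j]
    have e : ∀ p : ℕ × ℕ, T p.1 p.2 = v + 2 ↔ T p.1 p.2 = (v + 1) + 1 := fun p => Iff.rfl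
    have h1 := card_prefix hT (v + 1) i j
    have h2 := h.latt v i
    rw [cnt_succ] at h2
    show Nat.card {p : ℕ × ℕ // T p.1 p.2 = (v + 1) + 1 ∧ (p.1 < i ∨ (p.1 = i ∧ j ≤ p.2))} ≤ _
    rw [h1]
    omega

lemma isLR_exists_data {L : ℕ} {l m n : ℕ → ℕ} {T : ℕ → ℕ → ℕ} (h : IsLR l m n T)
    (hla : ∀ ⦃i j : ℕ⦄, i ≤ j → l j ≤ l i) (hma : ∀ ⦃i j : ℕ⦄, i ≤ j → m j ≤ m i)
    (hml : ∀ r, m r ≤ l r) (hl : ∀ r, L ≤ r → l r = 0) :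
    ∃ s, LRData L l m n s := by
  have hsupp : ∀ r x, T r x ≠ 0 ↔ m r ≤ x ∧ x < l r := fun r x => h.support (r, x)
  have hrow : ∀ r x y, m r ≤ x → x ≤ y → y < l r → T r x ≤ T r y := by
    intro r x y hx hxy
    induction y, hxy using Nat.le_induction with
    | base => intro _; exact le_rfl
    | succ y hy ih =>
      intro hyl
      exact (ih (by omega)).trans (h.row_weak r y ⟨by simp; omega, by simp; omega⟩
        ⟨by simp; omega, by simp; omega⟩)
  have hex : ∀ v r, ∃ t, m r ≤ t ∧ t ≤ l r ∧
      ∀ x, m r ≤ x → x < l r → (x < t ↔ T r x ≤ v) := by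
    intro v r
    have hE : ∃ x, m r ≤ x ∧ (l r ≤ x ∨ v < T r x) := ⟨l r, hml r, Or.inl le_rfl⟩
    classical
    have hs := Nat.find_spec hE
    refine ⟨Nat.find hE, hs.1, Nat.find_min' hE ⟨hml r, Or.inl le_rfl⟩, ?_⟩
    intro x hx hxl
    constructor
    · intro hlt
      have := Nat.find_min hE hlt
      by_contra hc
      exact this ⟨hx, Or.inr (by omega)⟩
    · intro hle
      by_contra hc
      rcases hs.2 with h1 | h1
      · omega
      · have := hrow r _ x hs.1 (by omega) hxl
        omega
  choose s hs1 hs2 hs3 using hex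
  have hT : ∀ r x v, T r x = v + 1 ↔ s v r ≤ x ∧ x < s (v + 1) r := by
    intro r x v
    constructor
    · intro e
      obtain ⟨h1, h2⟩ := (hsupp r x).1 (by omega)
      have h3 := hs3 v r x h1 h2
      have h4 := hs3 (v + 1) r x h1 h2
      omega
    · rintro ⟨h1, h2⟩
      have h5 := hs1 v r
      have h6 := hs2 (v + 1) r
      have h3 := hs3 v r x (by omega) (by omega)
      have h4 := hs3 (v + 1) r x (by omega) (by omega)
      omega
  have hmono : ∀ v r, s v r ≤ s (v + 1) r := by
    intro v r
    by_contra hc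
    have a1 := hs1 (v + 1) r
    have a2 := hs2 v r
    have a3 := hs3 v r (s (v + 1) r) a1 (by omega)
    have a4 := hs3 (v + 1) r (s (v + 1) r) a1 (by omega)
    omega
  have hlatt : ∀ v R, cnt s (v + 1) (R + 1) ≤ cnt s v R := by
    intro v R
    have h1 := h.lattice R (s (v + 1) R) v
    have h2 := card_prefix hT v R (s (v + 1) R)
    have h3 : Nat.card {p : ℕ × ℕ // T p.1 p.2 = v + 2 ∧
      (p.1 < R ∨ (p.1 = R ∧ s (v + 1) R ≤ p.2))} = _ := card_prefix hT (v + 1) R (s (v + 1) R)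
    rw [h2, h3] at h1
    rw [cnt_succ]
    have := hmono (v + 1) R
    rw [max_self] at h1
    omega
  have hcz : ∀ R v, R ≤ v → cnt s v R = 0 := by
    intro R
    induction R with
    | zero => intro v _; exact cnt_zero s v
    | succ R ih =>
      intro v hv
      obtain ⟨w, rfl⟩ : ∃ w, v = w + 1 := ⟨v - 1, by omega⟩
      have := hlatt w R
      rw [ih w (by omega)] at this
      omega
  have hconst : ∀ r v, r < v → s (v + 1) r = s v r := by
    intro r v hv
    have h1 := hcz (r + 1) v hv
    rw [cnt_succ] at h1
    have := hmono v r
    omega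
  refine ⟨s, ⟨?_, hmono, ?_, ?_, hlatt, ?_⟩⟩
  · intro r
    by_contra hc
    have a1 := hs1 0 r
    have a2 := hs2 0 r
    have a3 := hs3 0 r (m r) le_rfl (by omega)
    have a4 := hsupp r (m r)
    have a5 : T r (m r) ≠ 0 := a4.2 ⟨le_rfl, by omega⟩
    omega
  · intro v r
    by_contra hc
    have a1 := hs1 v r
    have a2 := hs2 (v + 1) (r + 1)
    have a3 := hla (show r ≤ r + 1 by omega)
    have a4 := hma (show r ≤ r + 1 by omega)
    have a5 := hs3 v r (s v r) a1 (by omega)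
    have a6 := hs3 (v + 1) (r + 1) (s v r) (by omega) (by omega)
    have a7 := h.col_strict r (s v r) ⟨by simp; omega, by simp; omega⟩
      ⟨by simp; omega, by simp; omega⟩
    omega
  · intro v r hv
    by_contra hc
    have a1 := hs1 v r
    have a2 := hs2 v r
    have a3 := hs3 v r (s v r) a1 (by omega)
    have a4 : ∀ w, v ≤ w → s w r = s v r := by
      intro w hw
      induction w, hw using Nat.le_induction with
      | base => rfl
      | succ w hw ih => rw [hconst r w (by omega), ih]
    have a5 := hs3 (T r (s v r)) r (s v r) a1 (by omega)
    have a6 := a4 (T r (s v r)) (by omega)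
    omega
  · intro v
    rw [← h.content v, card_all hT L v]
    intro r hr
    have := hs2 (v + 1) r
    rw [hl r hr] at this
    omega

lemma rotCompl_invol {k L : ℕ} {f : ℕ → ℕ} (h1 : ∀ i, f i ≤ k) (h2 : ∀ i, L ≤ i → f i = 0) :
    RotCompl k L (RotCompl k L f) = f := by
  funext i
  unfold RotCompl
  by_cases h : i < L
  · have e : L - 1 - (L - 1 - i) = i := by omega
    have := h1 i
    rw [if_pos h, if_pos (by omega), e]
    omega
  · rw [if_neg h, h2 i (by omega)]

lemma rotCompl_le (k L : ℕ) (f : ℕ → ℕ) (i : ℕ) : RotCompl k L f i ≤ k := by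
  unfold RotCompl
  split_ifs <;> omega

lemma rotCompl_zero (k L : ℕ) (f : ℕ → ℕ) (i : ℕ) (h : L ≤ i) : RotCompl k L f i = 0 := by
  unfold RotCompl
  rw [if_neg (by omega)]

lemma rotCompl_anti (k L : ℕ) {f : ℕ → ℕ} (hf : ∀ ⦃i j : ℕ⦄, i ≤ j → f j ≤ f i) ⦃i j : ℕ⦄
    (hij : i ≤ j) : RotCompl k L f j ≤ RotCompl k L f i := by
  unfold RotCompl
  have := hf (show L - 1 - j ≤ L - 1 - i by omega)
  split_ifs <;> omega

lemma rotCompl_isPartition (k L : ℕ) {f : ℕ → ℕ} (hf : ∀ ⦃i j : ℕ⦄, i ≤ j → f j ≤ f i) :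
    IsPartition (RotCompl k L f) :=
  ⟨rotCompl_anti k L hf, L, fun i hi => rotCompl_zero k L f i hi⟩

lemma LRData.first_le {L l m n s} (h : LRData L l m n s) (R : ℕ) :
    cnt s 0 (R + 1) + m R ≤ s 1 0 := by
  induction R with
  | zero =>
    have h1 := h.mono 0 0
    rw [cnt_succ, cnt_zero, ← h.zero]
    simp only [Nat.zero_add] at *
    omega
  | succ R ih =>
    have h1 := h.mono 0 (R + 1)
    have h2 := h.strip 0 R
    rw [cnt_succ, ← h.zero]
    rw [← h.zero] at ih
    simp only [Nat.zero_add] at *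
    omega

lemma cnt_mono (s : ℕ → ℕ → ℕ) (v : ℕ) {R R2 : ℕ} (h : R ≤ R2) : cnt s v R ≤ cnt s v R2 :=
  monotone_nat_of_le_succ (f := fun R => cnt s v R) (fun R => by rw [cnt_succ]; omega) h

/-- number of boxes in the first `R` rows of the `v`-th shape -/
def hv (s : ℕ → ℕ → ℕ) (v R : ℕ) : ℕ := ∑ r ∈ Finset.range R, s v r

lemma hv_succ (s : ℕ → ℕ → ℕ) (v R : ℕ) : hv s v (R + 1) = hv s v R + s v R := by
  simp [hv, Finset.sum_range_succ]

lemma LRData.hv_cnt {L l m n s} (h : LRData L l m n s) (v R : ℕ) :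
    hv s (v + 1) R = hv s v R + cnt s v R := by
  induction R with
  | zero => simp [hv, cnt]
  | succ R ih =>
    rw [hv_succ, hv_succ, cnt_succ, ih]
    have := h.mono v R
    omega

/-- rotated data -/
def rotS (k L : ℕ) (m : ℕ → ℕ) (s : ℕ → ℕ → ℕ) : ℕ → ℕ → ℕ :=
  fun i j => if j < i then RotCompl k L m j else cnt s (j - i) (L - i)

lemma LRData.rotate {k L l m n s} (h : LRData L l m n s) (hlk : ∀ r, l r ≤ k)
    (hma : ∀ ⦃i j : ℕ⦄, i ≤ j → m j ≤ m i) :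
    LRData L (RotCompl k L m) n (RotCompl k L l) (rotS k L m s) := by
  have hmono : ∀ v r, rotS k L m s v r ≤ rotS k L m s (v + 1) r := by
    intro v r
    unfold rotS
    rcases lt_trichotomy r v with hr | hr | hr
    · rw [if_pos hr, if_pos (by omega)]
    · subst hr
      rw [if_neg (by omega), if_pos (by omega)]
      by_cases hL : r < L
      · have h1 := h.first_le (L - 1 - r)
        have h2 := (h.le_top 1 0).trans (hlk 0)
        have e : L - 1 - r + 1 = L - r := by omega
        rw [e] at h1
        simp only [RotCompl, if_pos hL, Nat.sub_self]
        omega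
      · have e : L - r = 0 := by omega
        rw [e, cnt_zero]; omega
    · rw [if_neg (by omega), if_neg (by omega)]
      by_cases hL : v < L
      · have h1 := h.latt (r - (v + 1)) (L - (v + 1))
        have e1 : r - (v + 1) + 1 = r - v := by omega
        have e2 : L - (v + 1) + 1 = L - v := by omega
        rwa [e1, e2] at h1
      · have e : L - v = 0 := by omega
        rw [e, cnt_zero]; omega
  have htop : ∀ v r, r < v → rotS k L m s v r = RotCompl k L m r := by
    intro v r hr
    simp [rotS, hr]
  have hz : ∀ v R, (R ≤ v ∨ L ≤ v) → cnt (rotS k L m s) v R = 0 := by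
    intro v R hor
    apply Finset.sum_eq_zero
    intro r hr
    simp only [Finset.mem_range] at hr
    by_cases hrv : r < v
    · rw [htop _ _ hrv, htop _ _ (by omega)]; omega
    · have hLv : L ≤ v := by omega
      have : rotS k L m s (v + 1) r = 0 := by
        unfold rotS
        by_cases h1 : r < v + 1
        · rw [if_pos h1, rotCompl_zero _ _ _ _ (by omega)]
        · rw [if_neg h1, show L - (v + 1) = 0 by omega, cnt_zero]
      omega
  have key : ∀ v a, v < L → cnt (rotS k L m s) v (v + 1 + a) + hv s (a + 1) (L - v) =
      k + hv s a (L - v - 1) := by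
    intro v a hvL
    obtain ⟨q, hq⟩ : ∃ q, L = v + q + 1 := ⟨L - v - 1, by omega⟩
    have e1 : L - v = q + 1 := by omega
    have e2 : L - v - 1 = q := by omega
    have e3 : L - (v + 1) = q := by omega
    induction a with
    | zero =>
      rw [Nat.add_zero, cnt_succ, hz v v (Or.inl le_rfl), htop (v + 1) v (by omega)]
      have hm1 := hmono v v
      rw [htop (v + 1) v (by omega)] at hm1
      have e5 : rotS k L m s v v = cnt s 0 (q + 1) := by
        simp [rotS, e1]
      have e6 : RotCompl k L m v = k - m q := by
        simp only [RotCompl, if_pos hvL, show L - 1 - v = q by omega]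
      have e7 := (h.inner_le q).trans (hlk q)
      rw [e1, h.hv_cnt, hv_succ, h.zero]
      rw [e5, e6] at hm1 ⊢
      simp only [Nat.add_sub_cancel]
      omega
    | succ a ih =>
      rw [← Nat.add_assoc, cnt_succ]
      have hm1 := hmono v (v + 1 + a)
      have e5 : rotS k L m s v (v + 1 + a) = cnt s (a + 1) (q + 1) := by
        simp only [rotS, if_neg (show ¬ v + 1 + a < v by omega), e1,
          show v + 1 + a - v = a + 1 by omega]
      have e6 : rotS k L m s (v + 1) (v + 1 + a) = cnt s a q := by
        simp only [rotS, if_neg (show ¬ v + 1 + a < v + 1 by omega), e3,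
          show v + 1 + a - (v + 1) = a by omega]
      rw [e5, e6] at hm1 ⊢
      rw [e2, e1] at *
      have h1 := h.hv_cnt (a + 1) (q + 1)
      have h2 := h.hv_cnt a q
      omega
  refine ⟨?_, hmono, ?_, htop, ?_, ?_⟩
  · intro r
    simp [rotS, h.cont]
  · intro v r
    unfold rotS
    by_cases hr : r < v
    · rw [if_pos hr, if_pos (by omega)]
      exact rotCompl_anti k L hma (by omega)
    · rw [if_neg hr, if_neg (by omega), show r + 1 - (v + 1) = r - v by omega]
      exact cnt_mono s _ (by omega)
  · intro v R
    by_cases h1 : R ≤ v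
    · rw [hz (v + 1) (R + 1) (by omega)]; omega
    by_cases h2 : L ≤ v + 1
    · rw [hz (v + 1) (R + 1) (Or.inr h2)]; omega
    obtain ⟨a, rfl⟩ : ∃ a, R = v + 1 + a := ⟨R - v - 1, by omega⟩
    obtain ⟨q, hq⟩ : ∃ q, L = v + q + 2 := ⟨L - v - 2, by omega⟩
    have k1 := key v a (by omega)
    have k2 := key (v + 1) a (by omega)
    have e0 : v + 1 + 1 + a = v + 1 + a + 1 := by omega
    rw [show L - v - 1 = q + 1 by omega, show L - v = q + 1 + 1 by omega] at k1
    rw [show L - (v + 1) - 1 = q by omega, show L - (v + 1) = q + 1 by omega, e0] at k2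
    rw [hv_succ s (a + 1), hv_succ s a] at k1
    have := h.strip a q
    omega
  · intro v
    by_cases h2 : L ≤ v
    · rw [hz v L (Or.inr h2), rotCompl_zero _ _ _ _ h2]
    obtain ⟨q, hq⟩ : ∃ q, L = v + 1 + q := ⟨L - v - 1, by omega⟩
    have k1 := key v q (by omega)
    rw [← hq, show L - v - 1 = q by omega, show L - v = q + 1 by omega, hv_succ,
      h.top _ _ (by omega)] at k1
    have e1 : hv s (q + 1) q = hv s q q := by
      apply Finset.sum_congr rfl
      intro r hr
      simp only [Finset.mem_range] at hr
      rw [h.top _ _ (by omega), h.top _ _ hr]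
    have e2 := hlk q
    simp only [RotCompl, if_pos (show v < L by omega), show L - 1 - v = q by omega]
    omega

lemma data_col (L : ℕ) {l n : ℕ → ℕ} (hla : ∀ ⦃i j : ℕ⦄, i ≤ j → l j ≤ l i)
    (hna : ∀ ⦃i j : ℕ⦄, i ≤ j → n j ≤ n i) (hnl : ∀ r, n r ≤ l r) :
    ∃ c s, LRData L l n c s := by
  let s : ℕ → ℕ → ℕ := fun v r => if r < v then l r else min (l r) (n (r - v))
  refine ⟨fun v => cnt s v L, s, ⟨?_, ?_, ?_, ?_, ?_, fun _ => rfl⟩⟩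
  · intro r
    simp [s, hnl]
  · intro v r
    simp only [s]
    have := hna (show r - (v + 1) ≤ r - v by omega)
    split_ifs <;> omega
  · intro v r
    simp only [s]
    have := hla (show r ≤ r + 1 by omega)
    rw [show r + 1 - (v + 1) = r - v by omega]
    split_ifs <;> omega
  · intro v r hr
    simp [s, hr]
  · intro v R
    unfold cnt
    rw [Finset.sum_range_succ']
    have e : s (v + 1 + 1) 0 - s (v + 1) 0 = 0 := by simp [s]
    rw [e, Nat.add_zero]
    apply Finset.sum_le_sum
    intro r _
    simp only [s]
    have := hla (show r ≤ r + 1 by omega)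
    have := hna (show r - (v + 1) ≤ r - v by omega)
    rw [show r + 1 - (v + 1 + 1) = r - (v + 1) by omega, show r + 1 - (v + 1) = r - v by omega]
    split_ifs <;> omega

lemma LRData.cont_zero {L l m n s} (h : LRData L l m n s) (v : ℕ) (hv : L ≤ v) : n v = 0 := by
  rw [← h.cont]
  apply Finset.sum_eq_zero
  intro r hr
  simp only [Finset.mem_range] at hr
  rw [h.top _ _ (by omega), h.top _ _ (by omega)]
  omega

lemma LRData.cont_isPartition {L l m n s} (h : LRData L l m n s) : IsPartition n := by
  constructor
  · apply antitone_nat_of_succ_le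
    intro v
    rw [← h.cont, ← h.cont]
    exact (cnt_mono s _ (by omega)).trans (h.latt v L)
  · exact ⟨L, h.cont_zero⟩

lemma isLR_finite {L : ℕ} {l m n : ℕ → ℕ} (hla : ∀ ⦃i j : ℕ⦄, i ≤ j → l j ≤ l i)
    (hl : ∀ r, L ≤ r → l r = 0) (hn : ∀ v, L ≤ v → n v = 0) :
    Finite {T : ℕ → ℕ → ℕ // IsLR l m n T} := by
  have hbox : ∀ T, IsLR l m n T → ∀ r x, T r x ≠ 0 → r < L ∧ x < l 0 := by
    intro T hT r x hne
    have h1 : x < l r := ((hT.support (r, x)).1 hne).2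
    have h2 := hla (Nat.zero_le r)
    refine ⟨?_, by omega⟩
    by_contra hc
    have := hl r (by omega)
    omega
  have hbd : ∀ T, IsLR l m n T → ∀ r x, T r x < L + 1 := by
    intro T hT r x
    by_contra hc
    obtain ⟨v, hv⟩ : ∃ v, T r x = v + 1 := ⟨T r x - 1, by omega⟩
    have h1 := hT.content v
    rw [hn v (by omega)] at h1
    have hfin : Finite {p : ℕ × ℕ // T p.1 p.2 = v + 1} := by
      apply Set.Finite.subset ((Set.finite_Iio L).prod (Set.finite_Iio (l 0)))
      rintro ⟨r2, x2⟩ hp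
      have hp2 : T r2 x2 = v + 1 := hp
      have := hbox T hT r2 x2 (by omega)
      exact ⟨this.1, this.2⟩
    have hne : Nonempty {p : ℕ × ℕ // T p.1 p.2 = v + 1} := ⟨⟨(r, x), hv⟩⟩
    exact Nat.card_pos.ne' h1
  apply Finite.of_injective (β := Fin L → Fin (l 0) → Fin (L + 1))
    (fun T r x => ⟨T.1 r x, hbd T.1 T.2 r x⟩)
  rintro ⟨T, hT⟩ ⟨T2, hT2⟩ heq
  apply Subtype.ext
  funext r x
  show T r x = T2 r x
  by_cases hin : r < L ∧ x < l 0
  · have := congrFun (congrFun heq ⟨r, hin.1⟩) ⟨x, hin.2⟩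
    simpa using this
  · have h1 : T r x = 0 := by
      by_contra h; exact hin (hbox T hT r x h)
    have h2 : T2 r x = 0 := by
      by_contra h; exact hin (hbox T2 hT2 r x h)
    rw [h1, h2]

lemma LRData.LR_ne_zero {L l m n s} (h : LRData L l m n s)
    (hla : ∀ ⦃i j : ℕ⦄, i ≤ j → l j ≤ l i)
    (hl : ∀ r, L ≤ r → l r = 0) : LR l m n ≠ 0 := by
  obtain ⟨T, hT⟩ := h.exists_isLR hl
  have := isLR_finite (m := m) hla hl h.cont_zero
  have : Nonempty {T : ℕ → ℕ → ℕ // IsLR l m n T} := ⟨⟨T, hT⟩⟩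
  exact Nat.card_pos.ne'

lemma LR_exists {l m n : ℕ → ℕ} (h : LR l m n ≠ 0) : ∃ T, IsLR l m n T := by
  by_contra hc
  push Not at hc
  apply h
  have : IsEmpty {T : ℕ → ℕ → ℕ // IsLR l m n T} := ⟨fun T => hc T.1 T.2⟩
  exact Nat.card_of_isEmpty

lemma isLR_max {l m n : ℕ → ℕ} {T : ℕ → ℕ → ℕ} (h : IsLR l m n T) :
    IsLR (fun r => max (l r) (m r)) m n T := by
  have e : ∀ p, InSkew (fun r => max (l r) (m r)) m p ↔ InSkew l m p := by
    intro p
    simp only [InSkew]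
    omega
  refine ⟨?_, ?_, ?_, h.content, h.lattice⟩
  · intro p; rw [e]; exact h.support p
  · intro i j; rw [e, e]; exact h.row_weak i j
  · intro i j; rw [e, e]; exact h.col_strict i j

/-- The Durfee size of the Schubert product `[m] ⋆_{(k^L)} [n]` equals the
Durfee size of its cover partition `C`, which is the largest `d` with
`B (L-d) ≤ k - d` where `B` is the base partition of the associated skew
character of `A = (((k^L)/m)°)/n`. -/
theorem stmt19 (k L : ℕ) (m n : ℕ → ℕ) (hm : IsPartition m) (hn : IsPartition n)
    (hmk : ∀ i, m i ≤ k) (hmL : ∀ i, L ≤ i → m i = 0)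
    (hnk : ∀ i, n i ≤ k) (hnL : ∀ i, L ≤ i → n i = 0)
    (hsize : (∑ i ∈ Finset.range L, m i) + ∑ i ∈ Finset.range L, n i ≤ k * L)
    (hskew : ∀ i, n i ≤ RotCompl k L m i) :
    let B := SkewBase (RotCompl k L m) n
    let C : ℕ → ℕ := fun r => if r < L then k - B (L - 1 - r) else 0
    (sSup {d | ∃ e, IsPartition e ∧ (∀ r, e r ≤ k) ∧ (∀ r, L ≤ r → e r = 0) ∧
        LR e m n ≠ 0 ∧ ∀ i < d, d ≤ e i} =
      sSup {d | ∀ i < d, d ≤ C i}) ∧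
    (sSup {d | ∃ e, IsPartition e ∧ (∀ r, e r ≤ k) ∧ (∀ r, L ≤ r → e r = 0) ∧
        LR e m n ≠ 0 ∧ ∀ i < d, d ≤ e i} =
      sSup {d | d ≤ k ∧ d ≤ L ∧ B (L - d) ≤ k - d}) := by
  intro B C
  have hla := rotCompl_anti k L hm.1
  have hlz := rotCompl_zero k L m
  have hne : ∃ c, IsPartition c ∧ LR (RotCompl k L m) n c ≠ 0 := by
    obtain ⟨c, s, hs⟩ := data_col L hla hn.1 hskew
    exact ⟨c, hs.cont_isPartition, hs.LR_ne_zero hla hlz⟩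
  have hBle : ∀ i c, IsPartition c → LR (RotCompl k L m) n c ≠ 0 → B i ≤ c i :=
    fun i c h1 h2 => Nat.sInf_le ⟨c, h1, h2, rfl⟩
  have hBmem : ∀ i, ∃ c, IsPartition c ∧ LR (RotCompl k L m) n c ≠ 0 ∧ c i = B i := by
    intro i
    obtain ⟨c, h1, h2⟩ := hne
    exact Nat.sInf_mem (s := {x | ∃ c, IsPartition c ∧ LR (RotCompl k L m) n c ≠ 0 ∧ c i = x})
      ⟨c i, c, h1, h2, rfl⟩
  have hBanti : ∀ ⦃i j : ℕ⦄, i ≤ j → B j ≤ B i := by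
    intro i j hij
    obtain ⟨c, h1, h2, h3⟩ := hBmem i
    rw [← h3]
    exact (hBle j c h1 h2).trans (h1.1 hij)
  have hset1 : {d | ∃ e, IsPartition e ∧ (∀ r, e r ≤ k) ∧ (∀ r, L ≤ r → e r = 0) ∧
        LR e m n ≠ 0 ∧ ∀ i < d, d ≤ e i} = {d | d ≤ k ∧ d ≤ L ∧ B (L - d) ≤ k - d} := by
    ext d
    simp only [Set.mem_ofPred_eq]
    constructor
    · rintro ⟨e, he, hek, heL, hLR, hd⟩
      have hdk : d ≤ k := by
        rcases Nat.eq_zero_or_pos d with h0 | h0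
        · omega
        · exact (hd (d - 1) (by omega)).trans (hek _)
      have hdL : d ≤ L := by
        by_contra hc
        have h1 := hd (d - 1) (by omega)
        have h2 := heL (d - 1) (by omega)
        omega
      refine ⟨hdk, hdL, ?_⟩
      obtain ⟨T, hT⟩ := LR_exists hLR
      have hek2 : ∀ r, max (e r) (m r) ≤ k := fun r => max_le (hek r) (hmk r)
      have hea2 : ∀ ⦃i j : ℕ⦄, i ≤ j → max (e j) (m j) ≤ max (e i) (m i) :=
        fun i j hij => max_le_max (he.1 hij) (hm.1 hij)
      obtain ⟨s, hs⟩ := isLR_exists_data (L := L) (isLR_max hT) hea2 hm.1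
        (fun r => le_max_right _ _) (fun r hr => by simp [heL r hr, hmL r hr])
      have hs2 := hs.rotate hek2 hm.1
      have h3 := hBle (L - d) _ (rotCompl_isPartition k L hea2) (hs2.LR_ne_zero hla hlz)
      refine h3.trans ?_
      unfold RotCompl
      split_ifs with hlt
      · have h4 := hd (d - 1) (by omega)
        rw [show L - 1 - (L - d) = d - 1 by omega]
        have := le_max_left (e (d - 1)) (m (d - 1))
        show k - max (e (d - 1)) (m (d - 1)) ≤ k - d
        omega
      · omega
    · rintro ⟨hdk, hdL, hB⟩
      obtain ⟨c, hc, hLR, hcB⟩ := hBmem (L - d)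
      obtain ⟨T, hT⟩ := LR_exists hLR
      obtain ⟨s, hs⟩ := isLR_exists_data (L := L) hT hla hn.1 hskew hlz
      have hs2 := hs.rotate (rotCompl_le k L m) hn.1
      have hs3 := hs2.rotate (rotCompl_le k L n) hc.1
      rw [rotCompl_invol hmk hmL, rotCompl_invol hnk hnL] at hs3
      refine ⟨_, rotCompl_isPartition k L hc.1, rotCompl_le k L c, rotCompl_zero k L c,
        hs3.LR_ne_zero (rotCompl_anti k L hc.1) (rotCompl_zero k L c), ?_⟩
      intro i hi
      have h1 := hc.1 (show L - d ≤ L - 1 - i by omega)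
      simp only [RotCompl, if_pos (show i < L by omega)]
      omega
  have hset2 : {d | ∀ i < d, d ≤ C i} = {d | d ≤ k ∧ d ≤ L ∧ B (L - d) ≤ k - d} := by
    ext d
    simp only [Set.mem_ofPred_eq]
    constructor
    · intro hd
      rcases Nat.eq_zero_or_pos d with h0 | h0
      · subst h0
        refine ⟨Nat.zero_le _, Nat.zero_le _, ?_⟩
        have h0 : (0 : ℕ) ∈ {d | d ≤ k ∧ d ≤ L ∧ B (L - d) ≤ k - d} := by
          rw [← hset1]
          obtain ⟨c, hc, hLR⟩ := hne
          obtain ⟨T, hT⟩ := LR_exists hLR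
          obtain ⟨s, hs⟩ := isLR_exists_data (L := L) hT hla hn.1 hskew hlz
          have hs2 := hs.rotate (rotCompl_le k L m) hn.1
          have hs3 := hs2.rotate (rotCompl_le k L n) hc.1
          rw [rotCompl_invol hmk hmL, rotCompl_invol hnk hnL] at hs3
          exact ⟨_, rotCompl_isPartition k L hc.1, rotCompl_le k L c, rotCompl_zero k L c,
            hs3.LR_ne_zero (rotCompl_anti k L hc.1) (rotCompl_zero k L c),
            fun i hi => by omega⟩
        exact h0.2.2
      · have h1 := hd (d - 1) (by omega)
        simp only [C] at h1
        split_ifs at h1 with h2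
        · rw [show L - 1 - (d - 1) = L - d by omega] at h1
          omega
        · omega
    · rintro ⟨hdk, hdL, hB⟩ i hi
      have h1 := hBanti (show L - d ≤ L - 1 - i by omega)
      simp only [C, if_pos (show i < L by omega)]
      omega
  rw [hset1, hset2]
  exact ⟨rfl, rfl⟩
end
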